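/- For every matroid M with finite ground set E and rank r+1, the h-vector of the broken circuit complex of M is unimodal: there exists an index k₀ with 0 ≤ k₀ ≤ r+1 such that h_0 ≤ h_1 ≤ … ≤ h_{k₀} and h_{k₀} ≥ h_{k₀+1} ≥ … ≥ h_{r+1}. -/

import Mathlib

open Polynomial

/-- The rank of a set `X` in a matroid `M`: the supremum of the cardinalities of the
independent subsets of `X`. -/
noncomputable def matroidRank {α : Type*} (M : Matroid α) (X : Set α) : ℕ :=
  sSup {m | ∃ I ⊆ X, M.Indep I ∧ I.ncard = m}

/-- The characteristic polynomial of a matroid `M` of rank `r + 1` whose ground set is a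
finite type `α` :  `χ_M(q) = Σ_{S ⊆ E} (−1)^{|S|} q^{(r+1) − rk(S)}`. -/
noncomputable def matroidCharPoly {α : Type*} [Fintype α] (M : Matroid α) (r : ℕ) :
    Polynomial ℤ :=
  ∑ S : Finset α, (-1 : Polynomial ℤ) ^ S.card * X ^ (r + 1 - matroidRank M ↑S)

namespace BrokenCircuit

section

theorem exists_eigenbasis_bound {ι : Type*} [Fintype ι] [DecidableEq ι]
    (N : Matrix ι ι ℝ) (hN : N.IsHermitian) (ξ : ι → ℝ)
    (hone : ∀ z : ι → ℝ, ∀ t : ℝ, 0 < t → N.mulVec z = t • z → ∃ a : ℝ, z = a • ξ)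
    (g : ι → ℝ) (hg : ∑ i, g i * ξ i = 0) :
    ∃ y : ι → ℝ, ∑ i, (g i - N.mulVec y i) ^ 2 + 2 * ∑ i, g i * y i
      - ∑ i, y i * N.mulVec y i ≤ 0 := by
  let e := hN.eigenvectorBasis
  let t := hN.eigenvalues
  let γ : ι → ℝ := fun k => ∑ i, g i * e k i
  let c : ι → ℝ := fun k => if t k < 0 then γ k / t k else if t k = 0 then - γ k / 2 else 0
  let y : ι → ℝ := fun i => ∑ k, c k * e k i
  have hNy : ∀ i, N.mulVec y i = ∑ k, t k * c k * e k i := by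
    intro i
    have h1 : y = ∑ k, c k • (e k : ι → ℝ) := by
      ext i; simp [y, Finset.sum_apply]
    rw [h1, Matrix.mulVec_sum, Finset.sum_apply]
    refine Finset.sum_congr rfl fun k _ => ?_
    rw [Matrix.mulVec_smul, hN.mulVec_eigenvectorBasis]
    simp [t, e]; ring
  have ort : ∀ k l, ∑ i, e k i * e l i = if k = l then 1 else 0 := by
    intro k l
    have := orthonormal_iff_ite.mp e.orthonormal k l
    rw [← this, PiLp.inner_apply]
    simp [mul_comm]
  have hgexp : ∀ i, g i = ∑ k, γ k * e k i := by
    intro i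
    have := e.sum_repr (WithLp.toLp 2 g)
    have h2 := congrArg (fun z : EuclideanSpace ℝ ι => z i) this
    simp only [e.repr_apply_apply] at h2
    refine h2.symm.trans ?_
    simp [PiLp.inner_apply, γ, mul_comm]
  have pars : ∀ a b : ι → ℝ, ∑ i, (∑ k, a k * e k i) * (∑ k, b k * e k i) = ∑ k, a k * b k := by
    intro a b
    calc _ = ∑ i, ∑ k, ∑ l, a k * b l * (e k i * e l i) := by
          refine Finset.sum_congr rfl fun i _ => ?_
          rw [Finset.sum_mul_sum]
          refine Finset.sum_congr rfl fun k _ => Finset.sum_congr rfl fun l _ => by ring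
      _ = ∑ k, ∑ l, a k * b l * ∑ i, (e k i * e l i) := by
          rw [Finset.sum_comm]
          refine Finset.sum_congr rfl fun k _ => ?_
          rw [Finset.sum_comm]
          simp only [Finset.mul_sum]
      _ = _ := by simp [ort]
  refine ⟨y, ?_⟩
  have e1 : ∑ i, (g i - N.mulVec y i) ^ 2 = ∑ k, (γ k - t k * c k) ^ 2 := by
    have := pars (fun k => γ k - t k * c k) (fun k => γ k - t k * c k)
    simp only [← pow_two] at this
    rw [← this]
    refine Finset.sum_congr rfl fun i _ => ?_
    rw [hgexp i, hNy i, ← Finset.sum_sub_distrib]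
    simp only [sub_mul]
  have e2 : ∑ i, g i * y i = ∑ k, γ k * c k := by
    rw [← pars γ c]; exact Finset.sum_congr rfl fun i _ => by rw [← hgexp i]
  have e3 : ∑ i, y i * N.mulVec y i = ∑ k, c k * (t k * c k) := by
    rw [← pars c fun k => t k * c k]; exact Finset.sum_congr rfl fun i _ => by rw [hNy i]
  rw [e1, e2, e3, Finset.mul_sum, ← Finset.sum_add_distrib, ← Finset.sum_sub_distrib]
  refine Finset.sum_nonpos fun k _ => ?_
  rcases lt_trichotomy (t k) 0 with h | h | h
  · have : c k = γ k / t k := by simp [c, h]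
    rw [this]
    have h0 : t k ≠ 0 := h.ne
    have : (γ k - t k * (γ k / t k)) ^ 2 + 2 * (γ k * (γ k / t k)) -
      γ k / t k * (t k * (γ k / t k)) = γ k ^ 2 / t k := by field_simp; ring
    rw [this]
    exact div_nonpos_of_nonneg_of_nonpos (sq_nonneg _) h.le
  · have : c k = - γ k / 2 := by simp [c, h]
    rw [this, h]; ring_nf; exact le_refl _
  · have hc : c k = 0 := by simp [c, h.le.not_gt, h.ne']
    obtain ⟨a, ha⟩ := hone (e k) (t k) h (by
      have := hN.mulVec_eigenvectorBasis k
      simpa [t, e] using this)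
    have : γ k = 0 := by
      have : γ k = a * ∑ i, g i * ξ i := by
        rw [Finset.mul_sum]
        refine Finset.sum_congr rfl fun i _ => ?_
        have := congrFun ha i
        simp only [Pi.smul_apply, smul_eq_mul] at this
        rw [this]; ring
      rw [this, hg, mul_zero]
    rw [hc, this]; simp

theorem bochner {V : Type*} [AddCommGroup V] [Module ℝ V] (A : V →ₗ[ℝ] V →ₗ[ℝ] ℝ)
    (symm : ∀ x y, A x y = A y x) {ι : Type*} [Fintype ι] (D : ι → V) (v : V)
    (c : ι → ℝ) (hc : ∀ i, 0 < c i) (hv : ∀ x, A v x = ∑ i, c i * A (D i) x)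
    (hm : ∀ i, 0 < A (D i) v) (off : ∀ i j, i ≠ j → 0 ≤ A (D i) (D j))
    (conn : ∀ y : ι → ℝ, (∀ i j, i ≠ j → 0 < A (D i) (D j) → y i = y j) → ∀ i j, y i = y j)
    (H : ∀ x, A x x ≤ ∑ i, c i * A (D i) x ^ 2 / A (D i) v)
    (x : V) (hx : A v x = 0) : A x x ≤ 0 := by
  classical
  set m : ι → ℝ := fun i => A (D i) v with hmdef
  let d : ι → ℝ := fun i => √(c i / m i)
  have hd : ∀ i, 0 < d i := fun i => Real.sqrt_pos.mpr (div_pos (hc i) (hm i))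
  have hd2 : ∀ i, d i ^ 2 = c i / m i := fun i => Real.sq_sqrt (div_pos (hc i) (hm i)).le
  let N : Matrix ι ι ℝ := fun i j => d i * A (D i) (D j) * d j
  let ξ : ι → ℝ := fun i => c i / d i
  have hξ : ∀ i, 0 < ξ i := fun i => div_pos (hc i) (hd i)
  have hdξ : ∀ i, d i * ξ i = c i := fun i => by
    simp only [ξ]; field_simp [(hd i).ne']
  have hξm : ∀ i, ξ i = d i * m i := fun i => by
    have h2 := hd2 i
    have hmi := (hm i).ne'
    have := hd i
    simp only [ξ]
    rw [div_eq_iff this.ne', mul_right_comm, ← pow_two, h2, div_mul_cancel₀]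
    exact hmi
  have hN : N.IsHermitian := by
    refine Matrix.IsHermitian.ext fun i j => ?_
    simp only [N, star_trivial]
    rw [symm]; ring
  have hNξ : ∀ i, ∑ j, N i j * ξ j = ξ i := by
    intro i
    have : A (D i) v = ∑ j, c j * A (D i) (D j) := by
      rw [symm, hv]
      exact Finset.sum_congr rfl fun j _ => by rw [symm]
    rw [hξm i, hmdef]
    simp only
    rw [this, Finset.mul_sum]
    refine Finset.sum_congr rfl fun j _ => ?_
    rw [← hdξ j]; simp only [N]; ring
  let L : (ι → ℝ) → V := fun y => ∑ i, (d i * y i) • D i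
  have hAL : ∀ y i, d i * A (D i) (L y) = N.mulVec y i := by
    intro y i
    simp only [L, map_sum, map_smul, smul_eq_mul, Matrix.mulVec, dotProduct, Finset.mul_sum, N]
    exact Finset.sum_congr rfl fun j _ => by ring
  have hxL : ∀ x y, A x (L y) = ∑ i, (d i * A (D i) x) * y i := by
    intro x y
    simp only [L, map_sum, map_smul, smul_eq_mul]
    exact Finset.sum_congr rfl fun j _ => by rw [symm]; ring
  have key : ∀ x y, A x x ≤ ∑ i, (d i * A (D i) x - N.mulVec y i) ^ 2
      + 2 * ∑ i, d i * A (D i) x * y i - ∑ i, y i * N.mulVec y i := by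
    intro x y
    have h1 := H (x - L y)
    have h2 : A (x - L y) (x - L y) = A x x - 2 * A x (L y) + A (L y) (L y) := by
      simp only [map_sub, LinearMap.sub_apply]
      rw [symm (L y) x]; ring
    have h3 : A (L y) (L y) = ∑ i, y i * N.mulVec y i := by
      rw [hxL]
      exact Finset.sum_congr rfl fun i _ => by rw [hAL]; ring
    have h4 : ∑ i, c i * A (D i) (x - L y) ^ 2 / A (D i) v =
        ∑ i, (d i * A (D i) x - N.mulVec y i) ^ 2 := by
      refine Finset.sum_congr rfl fun i _ => ?_
      rw [← hAL, map_sub, ← mul_sub, mul_pow, hd2]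
      simp only [m]; ring
    rw [h2, h3, h4, hxL] at h1
    linarith
  have hone : ∀ z : ι → ℝ, ∀ t : ℝ, 0 < t → N.mulVec z = t • z → ∃ a : ℝ, z = a • ξ := by
    intro z t ht hz
    have hzi : ∀ i, ∑ j, N i j * z j = t * z i := fun i => by
      have := congrFun hz i
      simpa [Matrix.mulVec, dotProduct] using this
    have hq : ∑ i, ∑ j, N i j * ξ i * ξ j * (z i / ξ i - z j / ξ j) ^ 2 =
        2 * (1 - t) * ∑ i, z i ^ 2 := by
      have e1 : ∀ i j, N i j * ξ i * ξ j * (z i / ξ i - z j / ξ j) ^ 2 =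
          N i j * ξ j * (z i ^ 2 / ξ i) + N j i * ξ i * (z j ^ 2 / ξ j) - 2 * z i * (N i j * z j) := by
        intro i j
        have hs : N j i = N i j := by simpa using hN.apply i j
        rw [hs]
        have := (hξ i).ne'
        have := (hξ j).ne'
        field_simp; ring
      have e2 : ∑ i, ∑ j, N i j * ξ j * (z i ^ 2 / ξ i) = ∑ i, z i ^ 2 := by
        refine Finset.sum_congr rfl fun i _ => ?_
        rw [← Finset.sum_mul, hNξ]
        have := (hξ i).ne'
        field_simp
      have e3 : ∑ i, ∑ j, N j i * ξ i * (z j ^ 2 / ξ j) = ∑ i, z i ^ 2 := by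
        rw [Finset.sum_comm, e2]
      have e4 : ∑ i, ∑ j, 2 * z i * (N i j * z j) = 2 * t * ∑ i, z i ^ 2 := by
        rw [Finset.mul_sum]
        refine Finset.sum_congr rfl fun i _ => ?_
        rw [← Finset.mul_sum, hzi]; ring
      simp only [e1, Finset.sum_sub_distrib, Finset.sum_add_distrib, e2, e3, e4]
      ring
    have hterm : ∀ i j, 0 ≤ N i j * ξ i * ξ j * (z i / ξ i - z j / ξ j) ^ 2 := by
      intro i j
      by_cases hij : i = j
      · subst hij; simp
      · have := off i j hij
        have := hd i; have := hd j; have := hξ i; have := hξ j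
        positivity
    by_cases hz0 : ∑ i, z i ^ 2 = 0
    · refine ⟨0, funext fun i => ?_⟩
      have := (Finset.sum_eq_zero_iff_of_nonneg fun i _ => sq_nonneg (z i)).mp hz0 i
        (Finset.mem_univ i)
      simpa using this
    have hzpos : 0 < ∑ i, z i ^ 2 :=
      lt_of_le_of_ne (Finset.sum_nonneg fun i _ => sq_nonneg (z i)) (Ne.symm hz0)
    have ht1 : 1 ≤ t := by
      have h1 := key 0 z
      simp only [map_zero, mul_zero, zero_mul, Finset.sum_const_zero, zero_sub, neg_sq, hz,
        Pi.smul_apply, smul_eq_mul, add_zero] at h1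
      have e1 : ∑ i, (t * z i) ^ 2 = t ^ 2 * ∑ i, z i ^ 2 := by
        rw [Finset.mul_sum]; exact Finset.sum_congr rfl fun i _ => by ring
      have e2 : ∑ i, z i * (t * z i) = t * ∑ i, z i ^ 2 := by
        rw [Finset.mul_sum]; exact Finset.sum_congr rfl fun i _ => by ring
      rw [e1, e2] at h1
      by_contra hlt
      push Not at hlt
      nlinarith [mul_pos (mul_pos ht (sub_pos.mpr hlt)) hzpos]
    have hall : ∑ i, ∑ j, N i j * ξ i * ξ j * (z i / ξ i - z j / ξ j) ^ 2 = 0 := by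
      refine le_antisymm ?_ (Finset.sum_nonneg fun i _ => Finset.sum_nonneg fun j _ => hterm i j)
      rw [hq]; nlinarith
    have hcon : ∀ i j, z i / ξ i = z j / ξ j := by
      refine conn (fun i => z i / ξ i) fun i j _ hpos => ?_
      have h1 := (Finset.sum_eq_zero_iff_of_nonneg
        fun i _ => Finset.sum_nonneg fun j _ => hterm i j).mp hall i (Finset.mem_univ i)
      have h2 := (Finset.sum_eq_zero_iff_of_nonneg fun j _ => hterm i j).mp h1 j
        (Finset.mem_univ j)
      have h3 : 0 < N i j * ξ i * ξ j :=
        mul_pos (mul_pos (mul_pos (mul_pos (hd i) hpos) (hd j)) (hξ i)) (hξ j)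
      have h4 := (mul_eq_zero.mp h2).resolve_left h3.ne'
      exact sub_eq_zero.mp (pow_eq_zero_iff (two_ne_zero) |>.mp h4)
    rcases isEmpty_or_nonempty ι with hι | ⟨⟨i₀⟩⟩
    · exact ⟨0, funext fun i => hι.elim i⟩
    · refine ⟨z i₀ / ξ i₀, funext fun i => ?_⟩
      rw [Pi.smul_apply, smul_eq_mul, ← hcon i i₀, div_mul_cancel₀ _ (hξ i).ne']
  obtain ⟨y, hy⟩ := exists_eigenbasis_bound N hN ξ hone (fun i => d i * A (D i) x) (by
    rw [← hx, hv]
    exact Finset.sum_congr rfl fun i _ => by rw [← hdξ i]; ring)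
  exact (key x y).trans hy

theorem sq_ge_of_bochner {V : Type*} [AddCommGroup V] [Module ℝ V] (A : V →ₗ[ℝ] V →ₗ[ℝ] ℝ)
    (symm : ∀ x y, A x y = A y x) (v : V) (hv : 0 < A v v)
    (h : ∀ x, A v x = 0 → A x x ≤ 0) (x : V) : A x x * A v v ≤ A v x ^ 2 := by
  have h1 := h (x - (A v x / A v v) • v) (by
    simp only [map_sub, map_smul, smul_eq_mul]
    field_simp; ring)
  simp only [map_sub, map_smul, smul_eq_mul, LinearMap.sub_apply, LinearMap.smul_apply] at h1
  rw [symm x v] at h1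
  have : A v x / A v v * A v x = A v x ^ 2 / A v v := by ring
  have h2 : A v x / A v v * (A v x / A v v * A v v) = A v x ^ 2 / A v v := by field_simp
  rw [← le_div_iff₀ hv]
  linarith

end

section

variable {α : Type*} {F G H K : Finset α}

/-- The deviation of `u` at `H` from the linear interpolation, by cardinality, of its values
at `F` and `G`. -/
noncomputable def dev (F G : Finset α) (u : Finset α → ℝ) (H : Finset α) : ℝ :=
  u H - u F - (u G - u F) * ((H.card - F.card : ℝ) / (G.card - F.card))

theorem dev_add (u w : Finset α → ℝ) : dev F G (u + w) H = dev F G u H + dev F G w H := by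
  simp only [dev, Pi.add_apply]; ring

theorem dev_smul (a : ℝ) (u : Finset α → ℝ) : dev F G (a • u) H = a * dev F G u H := by
  simp only [dev, Pi.smul_apply, smul_eq_mul]; ring

theorem dev_eq_zero {u : Finset α → ℝ} (hF : u F = 0) (hG : u G = 0) (hH : u H = 0) :
    dev F G u H = 0 := by simp [dev, hF, hG, hH]

theorem dev_eq_zero_of_const {u : Finset α → ℝ} (hF : u F = u G) (hH : u H = u G) :
    dev F G u H = 0 := by simp [dev, hF, hH]

theorem dev_of_ends {u : Finset α → ℝ} (hF : u F = 0) (hG : u G = 0) : dev F G u H = u H := by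
  simp [dev, hF, hG]

theorem dev_pair_symm (hFK : F ⊂ K) (hKH : K ⊂ H) (hHG : H ⊂ G) (u w : Finset α → ℝ) :
    dev F G u H * dev F H w K + dev F G u K * dev K G w H =
      dev F G w H * dev F H u K + dev F G w K * dev K G u H := by
  have h1 : (F.card : ℝ) < K.card := by exact_mod_cast Finset.card_lt_card hFK
  have h2 : (K.card : ℝ) < H.card := by exact_mod_cast Finset.card_lt_card hKH
  have h3 : (H.card : ℝ) < G.card := by exact_mod_cast Finset.card_lt_card hHG
  simp only [dev]
  have e1 : (G.card - F.card : ℝ) ≠ 0 := by linarith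
  have e2 : (H.card - F.card : ℝ) ≠ 0 := by linarith
  have e3 : (G.card - K.card : ℝ) ≠ 0 := by linarith
  field_simp
  ring

/-- The indicator function of a set of subsets. -/
noncomputable def ind (U : Set (Finset α)) : Finset α → ℝ := U.indicator fun _ => 1

theorem ind_of_mem {U : Set (Finset α)} (h : H ∈ U) : ind U H = 1 := by simp [ind, h]

theorem ind_of_notMem {U : Set (Finset α)} (h : H ∉ U) : ind U H = 0 := by simp [ind, h]

theorem dev_ind_of_left {U : Set (Finset α)} (hU : IsUpperSet U) (hF : F ∈ U) (h1 : F ⊆ H)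
    (h2 : H ⊆ G) : dev F G (ind U) H = 0 := by
  refine dev_eq_zero_of_const ?_ ?_
  · rw [ind_of_mem hF, ind_of_mem (hU (h1.trans h2) hF)]
  · rw [ind_of_mem (hU h1 hF), ind_of_mem (hU (h1.trans h2) hF)]

theorem dev_ind_of_right {U : Set (Finset α)} (hU : IsUpperSet U) (hG : G ∉ U) (h1 : F ⊆ H)
    (h2 : H ⊆ G) : dev F G (ind U) H = 0 :=
  dev_eq_zero (ind_of_notMem fun h => hG (hU (h1.trans h2) h)) (ind_of_notMem hG)
    (ind_of_notMem fun h => hG (hU h2 h))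

theorem ind_eq_diff_add_inter (U V : Set (Finset α)) :
    ind U = ind (U \ V) + ind (U ∩ V) := by
  funext H
  by_cases hU : H ∈ U <;> by_cases hV : H ∈ V <;> simp [ind, hU, hV]

theorem ind_union_add_ind_inter (U V : Set (Finset α)) :
    ind (U ∪ V) + ind (U ∩ V) = ind U + ind V := by
  simp only [ind]
  exact Set.indicator_union_add_inter _ _ _

variable [DecidableEq α]

/-- The members of the family `L` strictly between `F` and `G`. -/
def between (L : Finset (Finset α)) (F G : Finset α) : Finset (Finset α) :=
  L.filter fun H => F ⊂ H ∧ H ⊂ G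

theorem mem_between {L : Finset (Finset α)} {F G H : Finset α} :
    H ∈ between L F G ↔ H ∈ L ∧ F ⊂ H ∧ H ⊂ G := Finset.mem_filter

/-- The linear form of degree one attached to a system `b` on the interval from `F` to `G`. -/
noncomputable def form₁ (L : Finset (Finset α)) (b : Finset α → Finset α → ℝ) (F G : Finset α)
    (u : Finset α → ℝ) : ℝ :=
  ∑ H ∈ between L F G, dev F G u H * (b F H * b H G)

/-- The restriction of `form₁` to the two factors cut out by `H`. -/
noncomputable def split₁ (L : Finset (Finset α)) (b : Finset α → Finset α → ℝ)
    (F H G : Finset α) (u : Finset α → ℝ) : ℝ :=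
  form₁ L b F H u * b H G + b F H * form₁ L b H G u

/-- The bilinear form attached to a system `b` on the interval from `F` to `G`. -/
noncomputable def form₂ (L : Finset (Finset α)) (b : Finset α → Finset α → ℝ) (F G : Finset α)
    (u w : Finset α → ℝ) : ℝ :=
  ∑ H ∈ between L F G, dev F G u H * split₁ L b F H G w

/-- The restriction of `form₂` to the two factors cut out by `H`. -/
noncomputable def split₂ (L : Finset (Finset α)) (b : Finset α → Finset α → ℝ)
    (F H G : Finset α) (u w : Finset α → ℝ) : ℝ :=
  form₂ L b F H u w * b H G + form₁ L b F H u * form₁ L b H G w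
    + form₁ L b F H w * form₁ L b H G u + b F H * form₂ L b H G u w

/-- The trilinear form attached to a system `b` on the interval from `F` to `G`. -/
noncomputable def form₃ (L : Finset (Finset α)) (b : Finset α → Finset α → ℝ) (F G : Finset α)
    (u w z : Finset α → ℝ) : ℝ :=
  ∑ H ∈ between L F G, dev F G u H * split₂ L b F H G w z

variable {L : Finset (Finset α)} {b : Finset α → Finset α → ℝ}

theorem form₁_add (u w : Finset α → ℝ) :
    form₁ L b F G (u + w) = form₁ L b F G u + form₁ L b F G w := by
  simp only [form₁, dev_add, add_mul, Finset.sum_add_distrib]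

theorem form₁_smul (a : ℝ) (u : Finset α → ℝ) :
    form₁ L b F G (a • u) = a * form₁ L b F G u := by
  simp only [form₁, dev_smul, Finset.mul_sum, mul_assoc]

theorem split₁_add (u w : Finset α → ℝ) :
    split₁ L b F H G (u + w) = split₁ L b F H G u + split₁ L b F H G w := by
  simp only [split₁, form₁_add]; ring

theorem split₁_smul (a : ℝ) (u : Finset α → ℝ) :
    split₁ L b F H G (a • u) = a * split₁ L b F H G u := by
  simp only [split₁, form₁_smul]; ring

theorem form₂_add_left (u u' w : Finset α → ℝ) :
    form₂ L b F G (u + u') w = form₂ L b F G u w + form₂ L b F G u' w := by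
  simp only [form₂, dev_add, add_mul, Finset.sum_add_distrib]

theorem form₂_smul_left (a : ℝ) (u w : Finset α → ℝ) :
    form₂ L b F G (a • u) w = a * form₂ L b F G u w := by
  simp only [form₂, dev_smul, Finset.mul_sum, mul_assoc]

theorem form₂_add_right (u w w' : Finset α → ℝ) :
    form₂ L b F G u (w + w') = form₂ L b F G u w + form₂ L b F G u w' := by
  simp only [form₂, split₁_add, mul_add, Finset.sum_add_distrib]

theorem form₂_smul_right (a : ℝ) (u w : Finset α → ℝ) :
    form₂ L b F G u (a • w) = a * form₂ L b F G u w := by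
  simp only [form₂, split₁_smul, Finset.mul_sum]
  exact Finset.sum_congr rfl fun H _ => by ring

theorem sum_between_comm (f : Finset α → Finset α → ℝ) :
    ∑ H ∈ between L F G, ∑ K ∈ between L F H, f K H =
      ∑ K ∈ between L F G, ∑ H ∈ between L K G, f K H := by
  refine Finset.sum_comm' fun H K => ?_
  simp only [mem_between]
  constructor
  · rintro ⟨⟨hH, -, hHG⟩, hK, hFK, hKH⟩
    exact ⟨⟨hH, hKH, hHG⟩, hK, hFK, hKH.trans hHG⟩
  · rintro ⟨⟨hH, hKH, hHG⟩, hK, hFK, -⟩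
    exact ⟨⟨hH, hFK.trans hKH, hHG⟩, hK, hFK, hKH⟩

theorem sum_dev_pairs (Z : Finset α → Finset α → ℝ) (u w : Finset α → ℝ) :
    ∑ H ∈ between L F G, dev F G u H * (∑ K ∈ between L F H, dev F H w K * Z K H
      + ∑ K ∈ between L H G, dev H G w K * Z H K) =
    ∑ K ∈ between L F G, ∑ H ∈ between L K G,
      (dev F G u H * dev F H w K + dev F G u K * dev K G w H) * Z K H := by
  simp only [mul_add, Finset.sum_add_distrib, add_mul]
  congr 1
  · rw [← sum_between_comm]
    simp only [Finset.mul_sum, mul_assoc]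
  · simp only [Finset.mul_sum, mul_assoc]

theorem sum_dev_pairs_symm (Z : Finset α → Finset α → ℝ) (u w : Finset α → ℝ) :
    ∑ H ∈ between L F G, dev F G u H * (∑ K ∈ between L F H, dev F H w K * Z K H
      + ∑ K ∈ between L H G, dev H G w K * Z H K) =
    ∑ H ∈ between L F G, dev F G w H * (∑ K ∈ between L F H, dev F H u K * Z K H
      + ∑ K ∈ between L H G, dev H G u K * Z H K) := by
  rw [sum_dev_pairs, sum_dev_pairs]
  refine Finset.sum_congr rfl fun K hK => Finset.sum_congr rfl fun H hH => ?_
  rw [mem_between] at hK hH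
  rw [dev_pair_symm hK.2.1 hH.2.1 hH.2.2]

theorem form₂_symm (u w : Finset α → ℝ) : form₂ L b F G u w = form₂ L b F G w u := by
  have h : ∀ u w, form₂ L b F G u w = ∑ H ∈ between L F G, dev F G u H *
      (∑ K ∈ between L F H, dev F H w K * (b F K * b K H * b H G)
      + ∑ K ∈ between L H G, dev H G w K * (b F H * b H K * b K G)) := by
    intro u w
    refine Finset.sum_congr rfl fun H _ => ?_
    simp only [split₁, form₁, Finset.sum_mul, Finset.mul_sum]
    congr 2 <;> exact Finset.sum_congr rfl fun K _ => by ring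
  rw [h, h]
  exact sum_dev_pairs_symm (fun K H => b F K * b K H * b H G) u w

theorem split₂_symm (u w : Finset α → ℝ) : split₂ L b F H G u w = split₂ L b F H G w u := by
  simp only [split₂, form₂_symm u w]; ring

theorem form₃_symm_left (u w z : Finset α → ℝ) :
    form₃ L b F G u w z = form₃ L b F G w u z := by
  have h : ∀ u w, form₃ L b F G u w z = ∑ H ∈ between L F G, dev F G u H *
      (∑ K ∈ between L F H, dev F H w K * (form₁ L b F K z * b K H * b H G
        + b F K * form₁ L b K H z * b H G + b F K * b K H * form₁ L b H G z)
      + ∑ K ∈ between L H G, dev H G w K * (form₁ L b F H z * b H K * b K G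
        + b F H * form₁ L b H K z * b K G + b F H * b H K * form₁ L b K G z)) := by
    intro u w
    refine Finset.sum_congr rfl fun H _ => ?_
    have e1 : ∑ K ∈ between L F H, dev F H w K * (form₁ L b F K z * b K H * b H G
        + b F K * form₁ L b K H z * b H G + b F K * b K H * form₁ L b H G z) =
        form₂ L b F H w z * b H G + form₁ L b F H w * form₁ L b H G z := by
      simp only [form₂, split₁]
      conv_rhs => rw [form₁, Finset.sum_mul, Finset.sum_mul, ← Finset.sum_add_distrib]
      exact Finset.sum_congr rfl fun K _ => by ring
    have e2 : ∑ K ∈ between L H G, dev H G w K * (form₁ L b F H z * b H K * b K G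
        + b F H * form₁ L b H K z * b K G + b F H * b H K * form₁ L b K G z) =
        form₁ L b F H z * form₁ L b H G w + b F H * form₂ L b H G w z := by
      simp only [form₂, split₁]
      conv_rhs => rw [form₁.eq_1 L b H G w, Finset.mul_sum, Finset.mul_sum,
        ← Finset.sum_add_distrib]
      exact Finset.sum_congr rfl fun K _ => by ring
    rw [e1, e2, split₂]
    ring
  rw [h, h]
  exact sum_dev_pairs_symm (fun K H => form₁ L b F K z * b K H * b H G
        + b F K * form₁ L b K H z * b H G + b F K * b K H * form₁ L b H G z) u w

theorem form₃_symm_right (u w z : Finset α → ℝ) :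
    form₃ L b F G u w z = form₃ L b F G u z w :=
  Finset.sum_congr rfl fun H _ => by rw [split₂_symm]

/-- The modification of the system `b` along an upper set. -/
noncomputable def modify (L : Finset (Finset α)) (U : Set (Finset α))
    (b : Finset α → Finset α → ℝ) : Finset α → Finset α → ℝ :=
  fun F G => b F G + form₁ L b F G (ind U)

theorem form₁_eq_zero {u : Finset α → ℝ} (h : ∀ H ∈ between L F G, dev F G u H = 0) :
    form₁ L b F G u = 0 :=
  Finset.sum_eq_zero fun H hH => by rw [h H hH, zero_mul]

theorem form₂_eq_zero {u : Finset α → ℝ} (h : ∀ H ∈ between L F G, dev F G u H = 0)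
    (w : Finset α → ℝ) : form₂ L b F G u w = 0 :=
  Finset.sum_eq_zero fun H hH => by rw [h H hH, zero_mul]

theorem form₂_eq_zero' {w : Finset α → ℝ} (h : ∀ H ∈ between L F G, dev F G w H = 0)
    (u : Finset α → ℝ) : form₂ L b F G u w = 0 := by
  rw [form₂_symm, form₂_eq_zero h]

theorem dev_ind_eq_zero {U : Set (Finset α)} (hU : IsUpperSet U) (h : F ∈ U ∨ G ∉ U) :
    ∀ H ∈ between L F G, dev F G (ind U) H = 0 := fun H hH => by
  rw [mem_between] at hH
  exact h.elim (fun h => dev_ind_of_left hU h hH.2.1.subset hH.2.2.subset)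
    fun h => dev_ind_of_right hU h hH.2.1.subset hH.2.2.subset

theorem form₁_modify {U : Set (Finset α)} (hU : IsUpperSet U) (u : Finset α → ℝ) :
    form₁ L (modify L U b) F G u = form₁ L b F G u + form₂ L b F G u (ind U) := by
  simp only [form₂]
  conv_lhs => rw [form₁]
  conv_rhs => rw [form₁, ← Finset.sum_add_distrib]
  refine Finset.sum_congr rfl fun H _ => ?_
  simp only [modify, split₁]
  by_cases hH : H ∈ U
  · rw [form₁_eq_zero (dev_ind_eq_zero (F := H) (G := G) hU (.inl hH))]; ring
  · rw [form₁_eq_zero (dev_ind_eq_zero (F := F) (G := H) hU (.inr hH))]; ring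

theorem split₁_modify {U : Set (Finset α)} (hU : IsUpperSet U) (u : Finset α → ℝ) :
    split₁ L (modify L U b) F H G u = split₁ L b F H G u + split₂ L b F H G u (ind U) := by
  simp only [split₁, split₂, form₁_modify hU, modify]
  by_cases hH : H ∈ U
  · rw [form₁_eq_zero (dev_ind_eq_zero (F := H) (G := G) hU (.inl hH)),
      form₂_eq_zero' (dev_ind_eq_zero (F := H) (G := G) hU (.inl hH))]; ring
  · rw [form₁_eq_zero (dev_ind_eq_zero (F := F) (G := H) hU (.inr hH)),
      form₂_eq_zero' (dev_ind_eq_zero (F := F) (G := H) hU (.inr hH))]; ring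

theorem form₂_modify {U : Set (Finset α)} (hU : IsUpperSet U) (u w : Finset α → ℝ) :
    form₂ L (modify L U b) F G u w = form₂ L b F G u w + form₃ L b F G (ind U) u w := by
  rw [form₃_symm_left, form₃_symm_right, form₂, form₂, form₃, ← Finset.sum_add_distrib]
  refine Finset.sum_congr rfl fun H _ => ?_
  rw [split₁_modify hU, mul_add]

theorem form₂_ind_diff {U V : Set (Finset α)} (hU : IsUpperSet U) (hV : IsUpperSet V) :
    form₂ L b F G (ind (U \ V)) (ind (V \ U)) = 0 := by
  have up : ∀ {W : Set (Finset α)}, IsUpperSet W → ∀ {K H : Finset α}, K ⊂ H → K ∈ W → H ∈ W :=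
    fun hW _ _ h => hW h.subset
  by_cases hFU : F ∈ U
  · refine form₂_eq_zero' (fun H hH => ?_) _
    rw [mem_between] at hH
    have hHU := up hU hH.2.1 hFU
    have hGU := up hU hH.2.2 hHU
    apply dev_eq_zero <;> apply ind_of_notMem <;> simp [*]
  by_cases hFV : F ∈ V
  · refine form₂_eq_zero (fun H hH => ?_) _
    rw [mem_between] at hH
    have hHU := up hV hH.2.1 hFV
    have hGU := up hV hH.2.2 hHU
    apply dev_eq_zero <;> apply ind_of_notMem <;> simp [*]
  have hF1 : ind (U \ V) F = 0 := ind_of_notMem (by simp [*])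
  have hF2 : ind (V \ U) F = 0 := ind_of_notMem (by simp [*])
  by_cases hGV : G ∉ V
  · refine form₂_eq_zero' (fun H hH => ?_) _
    rw [mem_between] at hH
    have hHV : H ∉ V := fun h => hGV (up hV hH.2.2 h)
    apply dev_eq_zero <;> apply ind_of_notMem <;> simp [*]
  by_cases hGU : G ∉ U
  · refine form₂_eq_zero (fun H hH => ?_) _
    rw [mem_between] at hH
    have hHV : H ∉ U := fun h => hGU (up hU hH.2.2 h)
    apply dev_eq_zero <;> apply ind_of_notMem <;> simp [*]
  push Not at hGU hGV
  have hG1 : ind (U \ V) G = 0 := ind_of_notMem (by simp [*])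
  have hG2 : ind (V \ U) G = 0 := ind_of_notMem (by simp [*])
  refine Finset.sum_eq_zero fun H hH => ?_
  by_cases hHm : H ∈ U \ V
  · have hH2 : ind (V \ U) H = 0 := ind_of_notMem fun h => h.2 hHm.1
    rw [split₁, form₁_eq_zero, form₁_eq_zero]
    · ring
    · intro K hK
      rw [mem_between] at hK
      exact dev_eq_zero hH2 hG2 (ind_of_notMem fun h => h.2 (up hU hK.2.1 hHm.1))
    · intro K hK
      rw [mem_between] at hK
      exact dev_eq_zero hF2 hH2 (ind_of_notMem fun h => hHm.2 (up hV hK.2.2 h.1))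
  · rw [dev_eq_zero hF1 hG1 (ind_of_notMem hHm), zero_mul]

theorem modify_modify {U V : Set (Finset α)} (hU : IsUpperSet U) (hV : IsUpperSet V) :
    modify L U (modify L V b) = modify L (U ∪ V) (modify L (U ∩ V) b) := by
  funext F G
  simp only [modify.eq_1 L _ (modify _ _ _), form₁_modify hV, form₁_modify (hU.inter hV)]
  simp only [modify]
  have hp : ind U = ind (U \ V) + ind (U ∩ V) := ind_eq_diff_add_inter U V
  have hq : ind V = ind (V \ U) + ind (U ∩ V) := by
    rw [Set.inter_comm]; exact ind_eq_diff_add_inter V U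
  have hr : ind (U ∪ V) = ind (U \ V) + ind (V \ U) + ind (U ∩ V) := by
    have := ind_union_add_ind_inter U V
    rw [hp, hq] at this
    have h2 := add_right_cancel (b := ind (U ∩ V)) (this.trans (by abel :
      _ = (ind (U \ V) + ind (V \ U) + ind (U ∩ V)) + ind (U ∩ V)))
    exact h2
  rw [hr, hp, hq]
  simp only [form₁_add, form₂_add_left, form₂_add_right, form₂_ind_diff hU hV]
  rw [form₂_symm (ind (V \ U))]
  ring

end

section

variable {α : Type*} [DecidableEq α]

/-- The axioms of a matroid rank function. -/
structure IsRank (r : Finset α → ℕ) : Prop where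
  empty : r ∅ = 0
  mono : Monotone r
  insert_le : ∀ i S, r (insert i S) ≤ r S + 1
  submod : ∀ S T, r (S ∪ T) + r (S ∩ T) ≤ r S + r T

namespace IsRank

variable {r : Finset α → ℕ} (hr : IsRank r)
include hr

theorem union_eq {S T : Finset α} (h : ∀ i ∈ T, r (insert i S) = r S) : r (S ∪ T) = r S := by
  induction T using Finset.induction_on with
  | empty => simp
  | insert i T hi ih =>
    have h1 := ih fun j hj => h j (Finset.mem_insert_of_mem hj)
    have h2 := hr.submod (S ∪ T) (insert i S)
    have h3 := h i (Finset.mem_insert_self i T)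
    have h4 : S ∪ insert i T = S ∪ T ∪ insert i S := by
      ext; simp only [Finset.mem_union, Finset.mem_insert]; tauto
    have h5 : r S ≤ r ((S ∪ T) ∩ insert i S) := hr.mono (by
      intro x hx; simp [hx])
    have h6 : r S ≤ r (S ∪ insert i T) := hr.mono Finset.subset_union_left
    rw [h4] at h6 ⊢
    omega

theorem insert_eq_of_subset {S T : Finset α} {i : α} (hST : S ⊆ T) (h : r (insert i S) = r S) :
    r (insert i T) = r T := by
  have h2 := hr.submod T (insert i S)
  have h4 : T ∪ insert i S = insert i T := by
    ext x; simp only [Finset.mem_union, Finset.mem_insert]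
    have := @hST x; tauto
  have h5 : r S ≤ r (T ∩ insert i S) := hr.mono (by
    intro x hx; simp [hx, hST hx])
  have h6 : r T ≤ r (insert i T) := hr.mono (Finset.subset_insert _ _)
  rw [h4] at h2
  omega

theorem le_add_card (S T : Finset α) : r (S ∪ T) ≤ r S + T.card := by
  induction T using Finset.induction_on with
  | empty => simp
  | insert i T hi ih =>
    rw [Finset.union_insert, Finset.card_insert_of_notMem hi]
    have := hr.insert_le i (S ∪ T)
    omega

end IsRank

/-- The sum of the weights `lam` over a subset. -/
def lin (lam : α → ℝ) (H : Finset α) : ℝ := ∑ i ∈ H, lam i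

omit [DecidableEq α] in
theorem lin_sub_lin {lam : α → ℝ} {F H : Finset α} [DecidableEq α] (h : F ⊆ H) :
    lin lam H - lin lam F = ∑ i ∈ H \ F, lam i := by
  simp only [lin]; rw [← Finset.sum_sdiff h]; ring

theorem ind_mem_eq_lin (i : α) : ind {H | i ∈ H} = lin (fun j => if j = i then 1 else 0) := by
  funext H
  by_cases h : i ∈ H <;> simp [ind, lin, h]

/-- A system is balanced if its linear forms annihilate all weights. -/
def Balanced (L : Finset (Finset α)) (b : Finset α → Finset α → ℝ) : Prop :=
  ∀ F ∈ L, ∀ G ∈ L, F ⊂ G → ∀ lam : α → ℝ, form₁ L b F G (lin lam) = 0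

namespace Balanced

variable {L : Finset (Finset α)} {b : Finset α → Finset α → ℝ} {F G H : Finset α}
  (hb : Balanced L b)
include hb

theorem split₁_lin (hF : F ∈ L) (hG : G ∈ L) (hH : H ∈ between L F G) (lam : α → ℝ) :
    split₁ L b F H G (lin lam) = 0 := by
  rw [mem_between] at hH
  rw [split₁, hb F hF H hH.1 hH.2.1, hb H hH.1 G hG hH.2.2]; ring

theorem form₂_lin (hF : F ∈ L) (hG : G ∈ L) (u : Finset α → ℝ) (lam : α → ℝ) :
    form₂ L b F G u (lin lam) = 0 :=
  Finset.sum_eq_zero fun H hH => by rw [hb.split₁_lin hF hG hH, mul_zero]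

theorem form₂_lin_left (hF : F ∈ L) (hG : G ∈ L) (u : Finset α → ℝ) (lam : α → ℝ) :
    form₂ L b F G (lin lam) u = 0 := by
  rw [form₂_symm, hb.form₂_lin hF hG]

theorem split₂_lin (hF : F ∈ L) (hG : G ∈ L) (hH : H ∈ between L F G) (u : Finset α → ℝ)
    (lam : α → ℝ) : split₂ L b F H G u (lin lam) = 0 := by
  rw [mem_between] at hH
  rw [split₂, hb F hF H hH.1 hH.2.1, hb H hH.1 G hG hH.2.2, hb.form₂_lin hF hH.1,
    hb.form₂_lin hH.1 hG]; ring

protected theorem modify {U : Set (Finset α)} (hU : IsUpperSet U) :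
    Balanced L (modify L U b) := fun F hF G hG hFG lam => by
  rw [form₁_modify hU, hb F hF G hG hFG, hb.form₂_lin_left hF hG, add_zero]

end Balanced

/-- The base system on a family of sets, depending on a parameter `ε`. -/
noncomputable def base (L : Finset (Finset α)) (r : Finset α → ℕ) (ε : ℝ) (F G : Finset α) : ℝ :=
  if r G ≤ r F + 1 then 1 else
    ε / (r G - r F - 1) * ∑ H ∈ (between L F G).attach,
      ((H.1.card - F.card : ℝ) * (G.card - H.1.card)) * (base L r ε F H.1 * base L r ε H.1 G)
termination_by G.card - F.card
decreasing_by
  all_goals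
    have h := mem_between.mp H.2
    have h1 := Finset.card_lt_card h.2.1
    have h2 := Finset.card_lt_card h.2.2
    omega

theorem base_of_le {L : Finset (Finset α)} {r : Finset α → ℕ} (ε : ℝ) {F G : Finset α}
    (h : r G ≤ r F + 1) : base L r ε F G = 1 := by
  rw [base, if_pos h]

theorem base_of_lt {L : Finset (Finset α)} {r : Finset α → ℕ} (ε : ℝ) {F G : Finset α}
    (h : r F + 1 < r G) : base L r ε F G = ε / (r G - r F - 1) * ∑ H ∈ between L F G,
      ((H.card - F.card : ℝ) * (G.card - H.card)) * (base L r ε F H * base L r ε H G) := by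
  rw [base, if_neg h.not_ge, ← Finset.sum_attach (between L F G)]

/-- A quadratic function whose deviations are the coefficients of `base`. -/
noncomputable def eta (ε : ℝ) (H : Finset α) : ℝ := -ε * (H.card : ℝ) ^ 2

omit [DecidableEq α] in
theorem dev_eta {F G H : Finset α} (ε : ℝ) (h : F ⊂ G) :
    dev F G (eta ε) H = ε * ((H.card - F.card : ℝ) * (G.card - H.card)) := by
  have h1 : (F.card : ℝ) < G.card := by exact_mod_cast Finset.card_lt_card h
  have e1 : (G.card - F.card : ℝ) ≠ 0 := by linarith
  simp only [dev, eta]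
  field_simp
  ring

variable [Fintype α]

/-- The flats of a rank function. -/
def flats (r : Finset α → ℕ) : Finset (Finset α) :=
  Finset.univ.filter fun H => ∀ i, i ∉ H → r H < r (insert i H)

theorem mem_flats {r : Finset α → ℕ} {H : Finset α} :
    H ∈ flats r ↔ ∀ i, i ∉ H → r H < r (insert i H) := by simp [flats]

theorem univ_mem_flats (r : Finset α → ℕ) : Finset.univ ∈ flats r := by simp [mem_flats]

/-- The closure of a set with respect to a rank function. -/
def clo (r : Finset α → ℕ) (S : Finset α) : Finset α :=
  Finset.univ.filter fun i => r (insert i S) = r S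

theorem mem_clo {r : Finset α → ℕ} {S : Finset α} {i : α} :
    i ∈ clo r S ↔ r (insert i S) = r S := by simp [clo]

theorem subset_clo (r : Finset α → ℕ) (S : Finset α) : S ⊆ clo r S := fun i hi => by
  rw [mem_clo, Finset.insert_eq_of_mem hi]

namespace IsRank

variable {r : Finset α → ℕ} (hr : IsRank r) {F G H S : Finset α}
include hr

theorem rank_clo (S : Finset α) : r (clo r S) = r S := by
  have := hr.union_eq (S := S) (T := clo r S) fun i hi => mem_clo.mp hi
  rwa [Finset.union_eq_right.mpr (subset_clo r S)] at this

theorem clo_mem (S : Finset α) : clo r S ∈ flats r := by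
  rw [mem_flats]
  intro i hi
  rw [hr.rank_clo]
  have h1 : r S ≤ r (insert i S) := hr.mono (Finset.subset_insert _ _)
  have h2 : r (insert i S) ≠ r S := fun h => hi (mem_clo.mpr h)
  have h3 : r (insert i S) ≤ r (insert i (clo r S)) :=
    hr.mono (Finset.insert_subset_insert _ (subset_clo r S))
  omega

theorem clo_subset (hG : G ∈ flats r) (h : S ⊆ G) : clo r S ⊆ G := by
  intro i hi
  by_contra hiG
  have := mem_flats.mp hG i hiG
  rw [hr.insert_eq_of_subset h (mem_clo.mp hi)] at this
  exact this.false

theorem lt_of_ssubset (hF : F ∈ flats r) (h : F ⊂ G) : r F < r G := by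
  obtain ⟨i, hiG, hiF⟩ := Finset.exists_of_ssubset h
  exact (mem_flats.mp hF i hiF).trans_le (hr.mono (Finset.insert_subset hiG h.subset))

theorem exists_cover (hF : F ∈ flats r) (hG : G ∈ flats r) (hFG : F ⊂ G) {i : α} (hi : i ∈ G)
    (hiF : i ∉ F) : ∃ H ∈ flats r, F ⊂ H ∧ H ⊆ G ∧ i ∈ H ∧ r H = r F + 1 := by
  refine ⟨clo r (insert i F), hr.clo_mem _, ?_, ?_, ?_, ?_⟩
  · exact (Finset.ssubset_insert hiF).trans_subset (subset_clo r _)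
  · exact hr.clo_subset hG (Finset.insert_subset hi hFG.subset)
  · exact subset_clo r _ (Finset.mem_insert_self i F)
  · rw [hr.rank_clo]
    have := mem_flats.mp hF i hiF
    have := hr.insert_le i F
    omega

theorem cover_unique (hF : F ∈ flats r) {H K : Finset α} (hH : H ∈ flats r) (hK : K ∈ flats r)
    (hFH : F ⊂ H) (hFK : F ⊂ K) (rH : r H = r F + 1) (rK : r K = r F + 1) {i : α}
    (hiF : i ∉ F) (hiH : i ∈ H) (hiK : i ∈ K) : H = K := by
  have key : ∀ H ∈ flats r, F ⊂ H → r H = r F + 1 → i ∈ H → H = clo r (insert i F) := by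
    intro H hH hFH rH hiH
    have h1 : insert i F ⊆ H := Finset.insert_subset hiH hFH.subset
    have h2 := mem_flats.mp hF i hiF
    refine (Finset.Subset.antisymm (fun j hj => ?_) (hr.clo_subset hH h1))
    rw [mem_clo]
    have h3 : r (insert j (insert i F)) ≤ r H := hr.mono (Finset.insert_subset hj h1)
    have h4 : r (insert i F) ≤ r (insert j (insert i F)) := hr.mono (Finset.subset_insert _ _)
    omega
  rw [key H hH hFH rH hiH, key K hK hFK rK hiK]

theorem sum_covers (hF : F ∈ flats r) (hG : G ∈ flats r) (hFG : F ⊂ G) (h2 : r F + 2 ≤ r G)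
    (f : α → ℝ) :
    ∑ H ∈ (between (flats r) F G).filter (fun H => r H = r F + 1), ∑ i ∈ H \ F, f i =
      ∑ i ∈ G \ F, f i := by
  rw [← Finset.sum_biUnion]
  · refine Finset.sum_congr (Finset.ext fun i => ?_) fun _ _ => rfl
    simp only [Finset.mem_biUnion, Finset.mem_filter, mem_between, Finset.mem_sdiff]
    constructor
    · rintro ⟨H, ⟨⟨-, -, hHG⟩, -⟩, hi, hiF⟩
      exact ⟨hHG.subset hi, hiF⟩
    · rintro ⟨hi, hiF⟩
      obtain ⟨H, hH, hFH, hHG, hiH, rH⟩ := hr.exists_cover hF hG hFG hi hiF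
      refine ⟨H, ⟨⟨hH, hFH, hHG.ssubset_of_ne ?_⟩, rH⟩, hiH, hiF⟩
      rintro rfl
      omega
  · intro H hH K hK hne
    simp only [Finset.coe_filter, mem_between, Set.mem_ofPred_eq] at hH hK
    refine Finset.disjoint_left.mpr fun i hiH hiK => hne ?_
    rw [Finset.mem_sdiff] at hiH hiK
    exact hr.cover_unique hF hH.1.1 hK.1.1 hH.1.2.1 hK.1.2.1 hH.2 hK.2 hiH.2 hiH.1 hiK.1

theorem between_eq_empty (hF : F ∈ flats r) (h : r G ≤ r F + 1) :
    between (flats r) F G = ∅ := by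
  refine Finset.eq_empty_of_forall_notMem fun H hH => ?_
  rw [mem_between] at hH
  have := hr.lt_of_ssubset hF hH.2.1
  have := hr.lt_of_ssubset hH.1 hH.2.2
  omega

theorem sum_lin_covers (hF : F ∈ flats r) (hG : G ∈ flats r) (hFG : F ⊂ G) (h2 : r F + 2 ≤ r G)
    (lam : α → ℝ) :
    ∑ H ∈ (between (flats r) F G).filter (fun H => r H = r F + 1), (lin lam H - lin lam F) =
      lin lam G - lin lam F := by
  rw [lin_sub_lin hFG.subset, ← hr.sum_covers hF hG hFG h2]
  refine Finset.sum_congr rfl fun H hH => ?_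
  rw [Finset.mem_filter, mem_between] at hH
  exact lin_sub_lin hH.1.2.1.subset

theorem sum_card_covers (hF : F ∈ flats r) (hG : G ∈ flats r) (hFG : F ⊂ G)
    (h2 : r F + 2 ≤ r G) :
    ∑ H ∈ (between (flats r) F G).filter (fun H => r H = r F + 1), (H.card - F.card : ℝ) =
      G.card - F.card := by
  have := hr.sum_lin_covers hF hG hFG h2 fun _ => 1
  simpa [lin] using this

end IsRank

section

variable {r : Finset α → ℕ} (hr : IsRank r) (ε : ℝ) {F G H : Finset α}
include hr

theorem form₁_base_eta (hF : F ∈ flats r) (hFG : F ⊂ G) :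
    form₁ (flats r) (base (flats r) r ε) F G (eta ε) =
      (r G - r F - 1) * base (flats r) r ε F G := by
  by_cases h : r G ≤ r F + 1
  · have h2 := hr.lt_of_ssubset hF hFG
    have h3 : (r G : ℝ) = r F + 1 := by exact_mod_cast (by omega : r G = r F + 1)
    rw [form₁, hr.between_eq_empty hF h, h3]; simp
  · push Not at h
    have h3 : (r F + 1 : ℝ) < r G := by exact_mod_cast h
    have h4 : (r G - r F - 1 : ℝ) ≠ 0 := by linarith
    rw [base_of_lt ε h, form₁, ← mul_assoc, mul_div_cancel₀ _ h4, Finset.mul_sum]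
    exact Finset.sum_congr rfl fun H _ => by rw [dev_eta ε hFG]; ring

theorem split₁_base_eta (hF : F ∈ flats r) (hH : H ∈ between (flats r) F G) :
    split₁ (flats r) (base (flats r) r ε) F H G (eta ε) =
      (r G - r F - 2) * (base (flats r) r ε F H * base (flats r) r ε H G) := by
  rw [mem_between] at hH
  rw [split₁, form₁_base_eta hr ε hF hH.2.1, form₁_base_eta hr ε hH.1 hH.2.2]
  ring

theorem form₂_base_eta (hF : F ∈ flats r) (u : Finset α → ℝ) :
    form₂ (flats r) (base (flats r) r ε) F G u (eta ε) =
      (r G - r F - 2) * form₁ (flats r) (base (flats r) r ε) F G u := by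
  rw [form₂, form₁, Finset.mul_sum]
  exact Finset.sum_congr rfl fun H hH => by rw [split₁_base_eta hr ε hF hH]; ring

theorem split₂_base_eta (hF : F ∈ flats r) (hH : H ∈ between (flats r) F G)
    (u : Finset α → ℝ) :
    split₂ (flats r) (base (flats r) r ε) F H G u (eta ε) =
      (r G - r F - 3) * split₁ (flats r) (base (flats r) r ε) F H G u := by
  rw [mem_between] at hH
  rw [split₂, split₁, form₁_base_eta hr ε hF hH.2.1, form₁_base_eta hr ε hH.1 hH.2.2,
    form₂_base_eta hr ε hF, form₂_base_eta hr ε hH.1]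
  ring

theorem balanced_base_of_eq (hF : F ∈ flats r) (hG : G ∈ flats r) (hFG : F ⊂ G)
    (h : r G = r F + 2) (lam : α → ℝ) :
    form₁ (flats r) (base (flats r) r ε) F G (lin lam) = 0 := by
  have hall : ∀ H ∈ between (flats r) F G, r H = r F + 1 := fun H hH => by
    rw [mem_between] at hH
    have := hr.lt_of_ssubset hF hH.2.1
    have := hr.lt_of_ssubset hH.1 hH.2.2
    omega
  have h1 := hr.sum_lin_covers hF hG hFG h.ge lam
  have h2 := hr.sum_card_covers hF hG hFG h.ge
  rw [Finset.filter_true_of_mem hall] at h1 h2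
  have h3 : (F.card : ℝ) < G.card := by exact_mod_cast Finset.card_lt_card hFG
  have e1 : (G.card - F.card : ℝ) ≠ 0 := by linarith
  have : form₁ (flats r) (base (flats r) r ε) F G (lin lam) =
      ∑ H ∈ between (flats r) F G, ((lin lam H - lin lam F) -
        (lin lam G - lin lam F) / (G.card - F.card) * (H.card - F.card)) := by
    refine Finset.sum_congr rfl fun H hH => ?_
    have := hall H hH
    rw [base_of_le ε (by omega : r H ≤ r F + 1), base_of_le ε (by omega : r G ≤ r H + 1), dev]
    ring
  rw [this, Finset.sum_sub_distrib, ← Finset.mul_sum, h1, h2, div_mul_cancel₀ _ e1, sub_self]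

end

theorem balanced_base {r : Finset α → ℕ} (hr : IsRank r) (ε : ℝ) :
    Balanced (flats r) (base (flats r) r ε) := by
  have key : ∀ n, ∀ F ∈ flats r, ∀ G ∈ flats r, F ⊂ G → r G ≤ r F + n → ∀ lam : α → ℝ,
      form₁ (flats r) (base (flats r) r ε) F G (lin lam) = 0 := by
    intro n
    induction n with
    | zero =>
      intro F hF G hG hFG h
      have := hr.lt_of_ssubset hF hFG
      omega
    | succ n ih =>
      intro F hF G hG hFG h lam
      rcases lt_trichotomy (r G) (r F + 2) with h2 | h2 | h2
      · rw [form₁, hr.between_eq_empty hF (by omega), Finset.sum_empty]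
      · exact balanced_base_of_eq hr ε hF hG hFG h2 lam
      · have h3 : (r F + 2 : ℝ) < r G := by exact_mod_cast h2
        have h4 : (r G - r F - 2 : ℝ) ≠ 0 := by linarith
        have h5 := form₂_base_eta hr ε (G := G) hF (lin lam)
        rw [form₂_symm, form₂, Finset.sum_eq_zero] at h5
        · exact (mul_eq_zero.mp h5.symm).resolve_left h4
        · intro H hH
          rw [mem_between] at hH
          have := hr.lt_of_ssubset hF hH.2.1
          have := hr.lt_of_ssubset hH.1 hH.2.2
          rw [split₁, ih F hF H hH.1 hH.2.1 (by omega), ih H hH.1 G hG hH.2.2 (by omega)]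
          ring
  exact fun F hF G hG hFG => key (r G) F hF G hG hFG (by omega)

theorem IsRank.between_nonempty {r : Finset α → ℕ} (hr : IsRank r) {F G : Finset α}
    (hF : F ∈ flats r) (hG : G ∈ flats r) (hFG : F ⊂ G) (h : r F + 2 ≤ r G) :
    (between (flats r) F G).Nonempty := by
  obtain ⟨i, hi, hiF⟩ := Finset.exists_of_ssubset hFG
  obtain ⟨H, hH, hFH, hHG, -, rH⟩ := hr.exists_cover hF hG hFG hi hiF
  refine ⟨H, mem_between.mpr ⟨hH, hFH, hHG.ssubset_of_ne ?_⟩⟩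
  rintro rfl
  omega

theorem base_pos {r : Finset α → ℕ} (hr : IsRank r) {ε : ℝ} (hε : 0 < ε) :
    ∀ F ∈ flats r, ∀ G ∈ flats r, F ⊂ G → 0 < base (flats r) r ε F G := by
  have key : ∀ n, ∀ F ∈ flats r, ∀ G ∈ flats r, F ⊂ G → r G ≤ r F + n →
      0 < base (flats r) r ε F G := by
    intro n
    induction n with
    | zero =>
      intro F hF G hG hFG h
      have := hr.lt_of_ssubset hF hFG
      omega
    | succ n ih =>
      intro F hF G hG hFG h
      rcases le_or_gt (r G) (r F + 1) with h2 | h2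
      · rw [base_of_le ε h2]; exact one_pos
      · have h3 : (r F + 1 : ℝ) < r G := by exact_mod_cast h2
        rw [base_of_lt ε h2]
        refine mul_pos (div_pos hε (by linarith)) (Finset.sum_pos (fun H hH => ?_)
          (hr.between_nonempty hF hG hFG h2))
        rw [mem_between] at hH
        have h4 := hr.lt_of_ssubset hF hH.2.1
        have h5 := hr.lt_of_ssubset hH.1 hH.2.2
        have h6 : (F.card : ℝ) < H.card := by exact_mod_cast Finset.card_lt_card hH.2.1
        have h7 : (H.card : ℝ) < G.card := by exact_mod_cast Finset.card_lt_card hH.2.2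
        exact mul_pos (mul_pos (by linarith) (by linarith))
          (mul_pos (ih F hF H hH.1 hH.2.1 (by omega)) (ih H hH.1 G hG hH.2.2 (by omega)))
  exact fun F hF G hG hFG => key (r G) F hF G hG hFG (by omega)

end

section

variable {α : Type*} [DecidableEq α]

/-- The bilinear form `form₂` as a bundled bilinear map. -/
noncomputable def bilin (L : Finset (Finset α)) (b : Finset α → Finset α → ℝ) (F G : Finset α) :
    (Finset α → ℝ) →ₗ[ℝ] (Finset α → ℝ) →ₗ[ℝ] ℝ :=
  LinearMap.mk₂ ℝ (form₂ L b F G) form₂_add_left form₂_smul_left form₂_add_right form₂_smul_right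

theorem bilin_apply (L : Finset (Finset α)) (b : Finset α → Finset α → ℝ) (F G : Finset α)
    (u w : Finset α → ℝ) : bilin L b F G u w = form₂ L b F G u w := rfl

section single

variable {L : Finset (Finset α)} {b : Finset α → Finset α → ℝ} {F G H K : Finset α}

theorem form₁_single (hF : K ≠ F) (hG : K ≠ G) :
    form₁ L b F G (Pi.single K 1) = if K ∈ between L F G then b F K * b K G else 0 := by
  have : ∀ H, dev F G (Pi.single K 1) H * (b F H * b H G) =
      if H = K then b F K * b K G else 0 := by
    intro H
    rw [dev_of_ends (Pi.single_eq_of_ne hF.symm _) (Pi.single_eq_of_ne hG.symm _)]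
    by_cases h : H = K
    · subst h; simp
    · simp [h]
  simp only [form₁, this, Finset.sum_ite_eq']

theorem form₂_single (hH : H ∈ between L F G) (w : Finset α → ℝ) :
    form₂ L b F G (Pi.single H 1) w = split₁ L b F H G w := by
  have h := mem_between.mp hH
  rw [form₂, Finset.sum_eq_single_of_mem H hH]
  · rw [dev_of_ends (Pi.single_eq_of_ne h.2.1.ne _) (Pi.single_eq_of_ne h.2.2.ne' _)]; simp
  · intro K _ hK
    rw [dev_of_ends (Pi.single_eq_of_ne h.2.1.ne _) (Pi.single_eq_of_ne h.2.2.ne' _),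
      Pi.single_eq_of_ne hK, zero_mul]

theorem split₁_single_nonneg (pos : ∀ F ∈ L, ∀ G ∈ L, F ⊂ G → 0 < b F G) (hF : F ∈ L)
    (hG : G ∈ L) (hH : H ∈ between L F G) (hK : K ∈ between L F G) (hne : H ≠ K) :
    0 ≤ split₁ L b F H G (Pi.single K 1) := by
  rw [mem_between] at hH hK
  rw [split₁, form₁_single hK.2.1.ne' hne.symm, form₁_single hne.symm hK.2.2.ne]
  have h1 := pos F hF H hH.1 hH.2.1
  have h2 := pos H hH.1 G hG hH.2.2
  refine add_nonneg (mul_nonneg ?_ h2.le) (mul_nonneg h1.le ?_)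
  · split_ifs with h
    · rw [mem_between] at h
      exact (mul_pos (pos F hF K h.1 h.2.1) (pos K h.1 H hH.1 h.2.2)).le
    · exact le_rfl
  · split_ifs with h
    · rw [mem_between] at h
      exact (mul_pos (pos H hH.1 K h.1 h.2.1) (pos K h.1 G hG h.2.2)).le
    · exact le_rfl

theorem split₁_single_pos (pos : ∀ F ∈ L, ∀ G ∈ L, F ⊂ G → 0 < b F G) (hF : F ∈ L)
    (hG : G ∈ L) (hH : H ∈ between L F G) (hK : K ∈ between L F G) (hHK : H ⊂ K) :
    0 < split₁ L b F H G (Pi.single K 1) := by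
  rw [mem_between] at hH hK
  rw [split₁, form₁_single hK.2.1.ne' hHK.ne', form₁_single hHK.ne' hK.2.2.ne,
    if_neg (fun h => (mem_between.mp h).2.2.asymm hHK), if_pos (mem_between.mpr ⟨hK.1, hHK, hK.2.2⟩),
    zero_mul, zero_add]
  exact mul_pos (pos F hF H hH.1 hH.2.1) (mul_pos (pos H hH.1 K hK.1 hHK) (pos K hK.1 G hG hK.2.2))

end single

theorem strong_product {d₁ d₂ A₁ A₂ X₁ X₂ b₁ b₂ : ℝ} (hd₁ : 0 < d₁) (hd₂ : 0 < d₂)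
    (h₁ : d₁ * A₁ * b₁ ≤ (d₁ - 1) * X₁ ^ 2) (h₂ : d₂ * A₂ * b₂ ≤ (d₂ - 1) * X₂ ^ 2) :
    (d₁ + d₂) * (A₁ * b₂ + X₁ * X₂ + X₁ * X₂ + b₁ * A₂) * (b₁ * b₂) ≤
      (d₁ + d₂ - 1) * (X₁ * b₂ + b₁ * X₂) ^ 2 := by
  have h3 := mul_le_mul_of_nonneg_left h₁ (by positivity : 0 ≤ (d₁ + d₂) * d₂ * b₂ ^ 2)
  have h4 := mul_le_mul_of_nonneg_left h₂ (by positivity : 0 ≤ (d₁ + d₂) * d₁ * b₁ ^ 2)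
  have h5 := sq_nonneg (d₂ * (X₁ * b₂) - d₁ * (b₁ * X₂))
  refine le_of_mul_le_mul_left (a := d₁ * d₂) ?_ (mul_pos hd₁ hd₂)
  nlinarith

variable [Fintype α] {r : Finset α → ℕ} (hr : IsRank r) {ε : ℝ} (hε : 0 < ε) {F G : Finset α}

include hr in
theorem IsRank.eq_of_comparable (hF : F ∈ flats r) (hG : G ∈ flats r) (h : r F + 3 ≤ r G)
    {β : Type*} (y : Finset α → β)
    (hy : ∀ H ∈ between (flats r) F G, ∀ K ∈ between (flats r) F G, H ⊂ K → y H = y K) :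
    ∀ H ∈ between (flats r) F G, ∀ K ∈ between (flats r) F G, y H = y K := by
  have point : ∀ H ∈ between (flats r) F G, ∃ p ∈ between (flats r) F G, r p = r F + 1 ∧
      y H = y p := by
    intro H hH
    have hH' := mem_between.mp hH
    obtain ⟨i, hi, hiF⟩ := Finset.exists_of_ssubset hH'.2.1
    obtain ⟨p, hp, hFp, hpH, -, rp⟩ := hr.exists_cover hF hH'.1 hH'.2.1 hi hiF
    have hpG : p ∈ between (flats r) F G :=
      mem_between.mpr ⟨hp, hFp, Finset.ssubset_of_subset_of_ssubset hpH hH'.2.2⟩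
    refine ⟨p, hpG, rp, ?_⟩
    rcases eq_or_ne p H with rfl | hne
    · rfl
    · exact (hy p hpG H hH (hpH.ssubset_of_ne hne)).symm
  intro H hH K hK
  obtain ⟨p, hp, rp, ep⟩ := point H hH
  obtain ⟨q, hq, rq, eq⟩ := point K hK
  rw [ep, eq]
  have hp' := mem_between.mp hp
  have hq' := mem_between.mp hq
  have h1 : r (clo r (p ∪ q)) ≤ r F + 2 := by
    rw [hr.rank_clo]
    have := hr.submod p q
    have : r F ≤ r (p ∩ q) := hr.mono (Finset.subset_inter hp'.2.1.subset hq'.2.1.subset)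
    omega
  have h2 : clo r (p ∪ q) ⊂ G := by
    refine (hr.clo_subset hG (Finset.union_subset hp'.2.2.subset hq'.2.2.subset)).ssubset_of_ne ?_
    intro h3
    rw [h3] at h1
    omega
  have h3 : p ⊆ clo r (p ∪ q) := Finset.subset_union_left.trans (subset_clo r _)
  have h4 : q ⊆ clo r (p ∪ q) := Finset.subset_union_right.trans (subset_clo r _)
  have hm : clo r (p ∪ q) ∈ between (flats r) F G :=
    mem_between.mpr ⟨hr.clo_mem _, Finset.ssubset_of_ssubset_of_subset hp'.2.1 h3, h2⟩
  have key : ∀ s ∈ between (flats r) F G, s ⊆ clo r (p ∪ q) → y s = y (clo r (p ∪ q)) := by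
    intro s hs hsub
    rcases eq_or_ne s (clo r (p ∪ q)) with he | hne
    · rw [← he]
    · exact hy s hs _ hm (hsub.ssubset_of_ne hne)
  rw [key p hp h3, key q hq h4]

include hr in
theorem exists_normalized (hF : F ∈ flats r) (hG : G ∈ flats r)
    {b : Finset α → Finset α → ℝ} (hb : Balanced (flats r) b) (u : Finset α → ℝ) :
    ∃ u' : Finset α → ℝ, u' F = 0 ∧ (∀ p ∈ between (flats r) F G, r p = r F + 1 → u' p = 0) ∧
      ∀ w, form₂ (flats r) b F G u w = form₂ (flats r) b F G u' w := by
  let lam : α → ℝ := fun i => if i ∈ F then 0 else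
    (u (clo r (insert i F)) - u F) / ((clo r (insert i F)).card - F.card)
  have hlF : lin lam F = 0 := Finset.sum_eq_zero fun i hi => by simp [lam, hi]
  refine ⟨u + (-1 : ℝ) • (fun _ => u F) + (-1 : ℝ) • lin lam, ?_, fun p hp rp => ?_, fun w => ?_⟩
  · simp [hlF]
  · rw [mem_between] at hp
    have h1 : ∀ i ∈ p \ F, lam i = (u p - u F) / (p.card - F.card) := by
      intro i hi
      rw [Finset.mem_sdiff] at hi
      have hFi := Finset.ssubset_insert hi.2
      have : clo r (insert i F) = p := by
        refine hr.cover_unique hF (hr.clo_mem _) hp.1 (hFi.trans_subset (subset_clo r _)) hp.2.1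
          ?_ rp hi.2 (subset_clo r _ (Finset.mem_insert_self i F)) hi.1
        rw [hr.rank_clo]
        have := mem_flats.mp hF i hi.2
        have := hr.insert_le i F
        omega
      simp only [lam, if_neg hi.2, this]
    have h2 : lin lam p = u p - u F := by
      have h3 := lin_sub_lin (lam := lam) hp.2.1.subset
      have h4 : (F.card : ℝ) < p.card := by exact_mod_cast Finset.card_lt_card hp.2.1
      rw [hlF, sub_zero, Finset.sum_congr rfl h1, Finset.sum_const, nsmul_eq_mul,
        Finset.card_sdiff_of_subset hp.2.1.subset,
        Nat.cast_sub (Finset.card_le_card hp.2.1.subset)] at h3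
      rw [h3, mul_div_cancel₀]
      linarith
    simp only [Pi.add_apply, Pi.smul_apply, smul_eq_mul, h2]; ring
  · rw [form₂_add_left, form₂_add_left, form₂_smul_left, form₂_smul_left,
      hb.form₂_lin_left hF hG, form₂_eq_zero (u := fun _ => u F) fun H _ => by simp [dev]]
    ring

include hr in
theorem form₂_base_of_normalized (hF : F ∈ flats r) (hG : G ∈ flats r) (hFG : F ⊂ G)
    (h : r G = r F + 3) {u w : Finset α → ℝ} (huF : u F = 0) (hwF : w F = 0)
    (hu : ∀ p ∈ between (flats r) F G, r p = r F + 1 → u p = 0)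
    (hw : ∀ p ∈ between (flats r) F G, r p = r F + 1 → w p = 0) :
    form₂ (flats r) (base (flats r) r ε) F G u w =
      u G * w G - ∑ H ∈ between (flats r) F G, u H * w H := by
  obtain ⟨i, hi, hiF⟩ := Finset.exists_of_ssubset hFG
  obtain ⟨p, hp, hFp, hpG', hip, rp⟩ := hr.exists_cover hF hG hFG hi hiF
  have hpG : p ⊂ G := hpG'.ssubset_of_ne (by rintro rfl; omega)
  have hpm : p ∈ between (flats r) F G := mem_between.mpr ⟨hp, hFp, hpG⟩
  have rank_cases : ∀ H ∈ between (flats r) F G, r H = r F + 1 ∨ r H = r F + 2 := by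
    intro H hH
    rw [mem_between] at hH
    have := hr.lt_of_ssubset hF hH.2.1
    have := hr.lt_of_ssubset hH.1 hH.2.2
    omega
  have hpoint : ∀ H ∈ between (flats r) F G, r H = r F + 1 →
      split₁ (flats r) (base (flats r) r ε) F H G w =
        ∑ K ∈ between (flats r) H G, w K - w G := by
    intro H hH rH
    have hH' := mem_between.mp hH
    have hc := hr.sum_card_covers hH'.1 hG hH'.2.2 (by omega)
    have hall : ∀ K ∈ between (flats r) H G, r K = r H + 1 := fun K hK => by
      rw [mem_between] at hK
      have := hr.lt_of_ssubset hH'.1 hK.2.1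
      have := hr.lt_of_ssubset hK.1 hK.2.2
      omega
    rw [Finset.filter_true_of_mem hall] at hc
    have h3 : (H.card : ℝ) < G.card := by exact_mod_cast Finset.card_lt_card hH'.2.2
    have e1 : (G.card - H.card : ℝ) ≠ 0 := by linarith
    rw [split₁, form₁, hr.between_eq_empty hF rH.le, Finset.sum_empty, zero_mul, zero_add,
      base_of_le ε rH.le, one_mul, form₁]
    have : ∀ K ∈ between (flats r) H G, dev H G w K * (base (flats r) r ε H K *
        base (flats r) r ε K G) = w K - w G / (G.card - H.card) * (K.card - H.card) := by
      intro K hK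
      have rK := hall K hK
      rw [base_of_le ε rK.le, base_of_le ε (by omega : r G ≤ r K + 1), dev, hw H hH rH]
      ring
    rw [Finset.sum_congr rfl this, Finset.sum_sub_distrib, ← Finset.mul_sum, hc,
      div_mul_cancel₀ _ e1]
  have hline : ∀ H ∈ between (flats r) F G, r H = r F + 2 →
      split₁ (flats r) (base (flats r) r ε) F H G w = - w H := by
    intro H hH rH
    have hH' := mem_between.mp hH
    have hc := hr.sum_card_covers hF hH'.1 hH'.2.1 (by omega)
    have hall : ∀ K ∈ between (flats r) F H, r K = r F + 1 := fun K hK => by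
      rw [mem_between] at hK
      have := hr.lt_of_ssubset hF hK.2.1
      have := hr.lt_of_ssubset hK.1 hK.2.2
      omega
    rw [Finset.filter_true_of_mem hall] at hc
    have h3 : (F.card : ℝ) < H.card := by exact_mod_cast Finset.card_lt_card hH'.2.1
    have e1 : (H.card - F.card : ℝ) ≠ 0 := by linarith
    rw [split₁, form₁.eq_1 _ _ H, hr.between_eq_empty hH'.1 (by omega), Finset.sum_empty, mul_zero,
      add_zero, base_of_le ε (by omega : r G ≤ r H + 1), mul_one, form₁]
    have : ∀ K ∈ between (flats r) F H, dev F H w K * (base (flats r) r ε F K *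
        base (flats r) r ε K H) = - w H / (H.card - F.card) * (K.card - F.card) := by
      intro K hK
      have rK := hall K hK
      have hK' := mem_between.mp hK
      rw [base_of_le ε rK.le, base_of_le ε (by omega : r H ≤ r K + 1), dev, hwF,
        hw K (mem_between.mpr ⟨hK'.1, hK'.2.1, hK'.2.2.trans hH'.2.2⟩) rK]
      ring
    rw [Finset.sum_congr rfl this, ← Finset.mul_sum, hc, div_mul_cancel₀ _ e1]
  let u' : Finset α → ℝ := u + (- u G) • ind {H | i ∈ H}
  have hu'F : u' F = 0 := by simp [u', huF, ind, hiF]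
  have hu'G : u' G = 0 := by simp [u', ind, hi]
  have e1 : form₂ (flats r) (base (flats r) r ε) F G u w =
      ∑ H ∈ between (flats r) F G, u' H * split₁ (flats r) (base (flats r) r ε) F H G w := by
    have e2 : form₂ (flats r) (base (flats r) r ε) F G u w =
        form₂ (flats r) (base (flats r) r ε) F G u' w := by
      rw [form₂_add_left, form₂_smul_left, ind_mem_eq_lin,
        (balanced_base hr ε).form₂_lin_left hF hG]
      ring
    rw [e2]
    exact Finset.sum_congr rfl fun H _ => by rw [dev_of_ends hu'F hu'G]
  have e3 : ∑ K ∈ between (flats r) p G, w K =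
      ∑ H ∈ (between (flats r) F G).filter (fun H => ¬ r H = r F + 1), ind {H | i ∈ H} H * w H := by
    have : between (flats r) p G =
        ((between (flats r) F G).filter (fun H => ¬ r H = r F + 1)).filter (fun H => i ∈ H) := by
      ext H
      simp only [Finset.mem_filter, mem_between]
      constructor
      · rintro ⟨hH, hpH, hHG⟩
        have := hr.lt_of_ssubset hp hpH
        exact ⟨⟨⟨hH, hFp.trans hpH, hHG⟩, by omega⟩, hpH.subset hip⟩
      · rintro ⟨⟨⟨hH, hFH, hHG⟩, hrH⟩, hiH⟩
        refine ⟨hH, ?_, hHG⟩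
        obtain ⟨q, hq, hFq, hqH, hiq, rq⟩ := hr.exists_cover hF hH hFH hiH hiF
        rw [hr.cover_unique hF hp hq hFp hFq rp rq hiF hip hiq]
        exact hqH.ssubset_of_ne fun he => hrH (he ▸ rq)
    rw [this, Finset.sum_filter]
    refine Finset.sum_congr rfl fun H _ => ?_
    by_cases hiH : i ∈ H <;> simp [ind, hiH]
  rw [e1, ← Finset.sum_filter_add_sum_filter_not _ (fun H => r H = r F + 1),
    ← Finset.sum_filter_add_sum_filter_not (between (flats r) F G) (fun H => r H = r F + 1)
      (fun H => u H * w H)]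
  have e4 : ∑ H ∈ (between (flats r) F G).filter (fun H => r H = r F + 1), u H * w H = 0 :=
    Finset.sum_eq_zero fun H hH => by
      rw [Finset.mem_filter] at hH
      rw [hu H hH.1 hH.2, zero_mul]
  have e5 : ∑ H ∈ (between (flats r) F G).filter (fun H => r H = r F + 1),
      u' H * split₁ (flats r) (base (flats r) r ε) F H G w =
      - u G * (∑ K ∈ between (flats r) p G, w K - w G) := by
    rw [Finset.sum_eq_single_of_mem p (Finset.mem_filter.mpr ⟨hpm, rp⟩), hpoint p hpm rp]
    · simp [u', ind, hip, hu p hpm rp]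
    · intro H hH hne
      rw [Finset.mem_filter] at hH
      have hH' := mem_between.mp hH.1
      have : i ∉ H := fun hiH => hne
        (hr.cover_unique hF hH'.1 hp hH'.2.1 hFp hH.2 rp hiF hiH hip)
      simp [u', ind, this, hu H hH.1 hH.2]
  have e6 : ∑ H ∈ (between (flats r) F G).filter (fun H => ¬ r H = r F + 1),
      u' H * split₁ (flats r) (base (flats r) r ε) F H G w =
      u G * ∑ K ∈ between (flats r) p G, w K -
        ∑ H ∈ (between (flats r) F G).filter (fun H => ¬ r H = r F + 1), u H * w H := by
    rw [e3, Finset.mul_sum, ← Finset.sum_sub_distrib]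
    refine Finset.sum_congr rfl fun H hH => ?_
    rw [Finset.mem_filter] at hH
    rw [hline H hH.1 ((rank_cases H hH.1).resolve_left hH.2)]
    simp only [u', Pi.add_apply, Pi.smul_apply, smul_eq_mul]
    ring
  rw [e4, e5, e6]
  ring

include hr in
theorem base_form₂_nonpos_of_eq (hF : F ∈ flats r) (hG : G ∈ flats r) (hFG : F ⊂ G)
    (h : r G = r F + 3) (hpos : 0 < form₂ (flats r) (base (flats r) r ε) F G (eta ε) (eta ε))
    (x : Finset α → ℝ) (hx : form₂ (flats r) (base (flats r) r ε) F G (eta ε) x = 0) :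
    form₂ (flats r) (base (flats r) r ε) F G x x ≤ 0 := by
  obtain ⟨u, huF, hu, eu⟩ := exists_normalized hr hF hG (balanced_base hr ε) x
  obtain ⟨w, hwF, hw, ew⟩ := exists_normalized hr hF hG (balanced_base hr ε) (eta ε)
  rw [eu, form₂_symm, eu, form₂_base_of_normalized hr hF hG hFG h huF huF hu hu]
  rw [ew, form₂_symm, eu, form₂_base_of_normalized hr hF hG hFG h huF hwF hu hw] at hx
  rw [ew, form₂_symm, ew, form₂_base_of_normalized hr hF hG hFG h hwF hwF hw hw] at hpos
  have cs := Finset.sum_mul_sq_le_sq_mul_sq (between (flats r) F G) u w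
  rw [← sub_eq_zero.mp hx, mul_pow] at cs
  simp only [← pow_two] at hpos ⊢
  have h1 : 0 ≤ ∑ H ∈ between (flats r) F G, u H ^ 2 := Finset.sum_nonneg fun _ _ => sq_nonneg _
  have h2 : 0 ≤ ∑ H ∈ between (flats r) F G, w H ^ 2 := Finset.sum_nonneg fun _ _ => sq_nonneg _
  have h3 : 0 < w G ^ 2 := by linarith
  refine le_of_mul_le_mul_right ?_ h3
  nlinarith

include hr in
theorem form_eq_zero_of_le (hF : F ∈ flats r) (h : r G ≤ r F + 1) (b : Finset α → Finset α → ℝ)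
    (u w : Finset α → ℝ) : form₁ (flats r) b F G u = 0 ∧ form₂ (flats r) b F G u w = 0 := by
  simp [form₁, form₂, hr.between_eq_empty hF h]

include hr in
theorem form₂_eq_zero_of_le (hF : F ∈ flats r) (h : r G ≤ r F + 2)
    (b : Finset α → Finset α → ℝ) (u w : Finset α → ℝ) : form₂ (flats r) b F G u w = 0 := by
  refine Finset.sum_eq_zero fun H hH => ?_
  rw [mem_between] at hH
  have h1 := hr.lt_of_ssubset hF hH.2.1
  have h2 := hr.lt_of_ssubset hH.1 hH.2.2
  rw [split₁, (form_eq_zero_of_le hr hF (by omega) b w w).1,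
    (form_eq_zero_of_le hr hH.1 (by omega) b w w).1]
  ring

include hr in
theorem split₂_strong (hF : F ∈ flats r) {H : Finset α}
    (hH : H ∈ between (flats r) F G) {b : Finset α → Finset α → ℝ} (u : Finset α → ℝ)
    (h₁ : (r H - r F - 1 : ℝ) * form₂ (flats r) b F H u u * b F H ≤
      (r H - r F - 2) * form₁ (flats r) b F H u ^ 2)
    (h₂ : (r G - r H - 1 : ℝ) * form₂ (flats r) b H G u u * b H G ≤
      (r G - r H - 2) * form₁ (flats r) b H G u ^ 2) :
    (r G - r F - 2 : ℝ) * split₂ (flats r) b F H G u u * (b F H * b H G) ≤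
      (r G - r F - 3) * split₁ (flats r) b F H G u ^ 2 := by
  rw [mem_between] at hH
  have l1 := hr.lt_of_ssubset hF hH.2.1
  have l2 := hr.lt_of_ssubset hH.1 hH.2.2
  rw [split₂, split₁]
  rcases Nat.lt_or_ge (r F + 1) (r H) with k1 | k1
  · rcases Nat.lt_or_ge (r H + 1) (r G) with k2 | k2
    · have k1' : (r F + 1 : ℝ) < r H := by exact_mod_cast k1
      have k2' : (r H + 1 : ℝ) < r G := by exact_mod_cast k2
      have := strong_product (d₁ := r H - r F - 1) (d₂ := r G - r H - 1) (by linarith)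
        (by linarith) (A₁ := form₂ (flats r) b F H u u) (A₂ := form₂ (flats r) b H G u u)
        (X₁ := form₁ (flats r) b F H u) (X₂ := form₁ (flats r) b H G u)
        (b₁ := b F H) (b₂ := b H G) (by linarith) (by linarith)
      linarith
    · obtain ⟨e1, e2⟩ := form_eq_zero_of_le hr hH.1 k2 b u u
      have e3 : (r G : ℝ) = r H + 1 := by exact_mod_cast (by omega : r G = r H + 1)
      rw [e1, e2, e3]
      have := mul_le_mul_of_nonneg_right h₁ (sq_nonneg (b H G))
      linarith
  · obtain ⟨e1, e2⟩ := form_eq_zero_of_le hr hF k1 b u u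
    have e3 : (r H : ℝ) = r F + 1 := by exact_mod_cast (by omega : r H = r F + 1)
    rw [e3] at h₂
    rw [e1, e2]
    have := mul_le_mul_of_nonneg_right h₂ (sq_nonneg (b F H))
    linarith

include hr in
theorem base_form₂_eq (hF : F ∈ flats r) (u w : Finset α → ℝ) :
    (r G - r F - 3) * form₂ (flats r) (base (flats r) r ε) F G u w =
      ∑ H ∈ between (flats r) F G, dev F G (eta ε) H *
        split₂ (flats r) (base (flats r) r ε) F H G u w := by
  have : form₃ (flats r) (base (flats r) r ε) F G (eta ε) u w =
      form₃ (flats r) (base (flats r) r ε) F G u w (eta ε) := by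
    rw [form₃_symm_left, form₃_symm_right]
  rw [form₃.eq_1 _ _ F G (eta ε)] at this
  rw [this, form₃, form₂, Finset.mul_sum]
  exact Finset.sum_congr rfl fun H hH => by rw [split₂_base_eta hr ε hF hH]; ring

include hr hε in
theorem base_form₂_nonpos (hF : F ∈ flats r) (hG : G ∈ flats r)
    (h : r F + 4 ≤ r G)
    (ih : ∀ u, ∀ H ∈ between (flats r) F G,
      (r G - r F - 2 : ℝ) * split₂ (flats r) (base (flats r) r ε) F H G u u *
        (base (flats r) r ε F H * base (flats r) r ε H G) ≤
        (r G - r F - 3) * split₁ (flats r) (base (flats r) r ε) F H G u ^ 2)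
    (x : Finset α → ℝ) (hx : form₂ (flats r) (base (flats r) r ε) F G (eta ε) x = 0) :
    form₂ (flats r) (base (flats r) r ε) F G x x ≤ 0 := by
  have hd : (r F + 4 : ℝ) ≤ r G := by exact_mod_cast h
  have pos := base_pos hr hε
  have cpos : ∀ H ∈ between (flats r) F G, 0 < dev F G (eta ε) H := by
    intro H hH
    rw [mem_between] at hH
    rw [dev_eta ε (hH.2.1.trans hH.2.2)]
    have h6 : (F.card : ℝ) < H.card := by exact_mod_cast Finset.card_lt_card hH.2.1
    have h7 : (H.card : ℝ) < G.card := by exact_mod_cast Finset.card_lt_card hH.2.2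
    exact mul_pos hε (mul_pos (by linarith) (by linarith))
  have bpos : ∀ H ∈ between (flats r) F G,
      0 < base (flats r) r ε F H * base (flats r) r ε H G := by
    intro H hH
    rw [mem_between] at hH
    exact mul_pos (pos F hF H hH.1 hH.2.1) (pos H hH.1 G hG hH.2.2)
  let b := base (flats r) r ε
  refine bochner (bilin (flats r) b F G) form₂_symm
    (ι := {H // H ∈ between (flats r) F G}) (fun H => Pi.single H.1 1) (eta ε)
    (fun H => dev F G (eta ε) H.1) (fun H => cpos H.1 H.2) ?_ ?_ ?_ ?_ ?_ x hx
  · intro x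
    rw [bilin_apply, form₂, ← Finset.sum_coe_sort]
    exact Finset.sum_congr rfl fun H _ => by rw [bilin_apply, form₂_single H.2]
  · intro H
    rw [bilin_apply, form₂_single H.2, split₁_base_eta hr ε hF H.2]
    exact mul_pos (by linarith) (bpos H.1 H.2)
  · intro H K hne
    rw [bilin_apply, form₂_single H.2]
    exact split₁_single_nonneg pos hF hG H.2 K.2 fun h => hne (Subtype.ext h)
  · intro y hy H K
    have := hr.eq_of_comparable hF hG (by omega)
      (fun H => if h : H ∈ between (flats r) F G then y ⟨H, h⟩ else 0) (fun H hH K hK hHK => by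
        simp only [hH, hK, dif_pos]
        refine hy ⟨H, hH⟩ ⟨K, hK⟩ (fun h => hHK.ne (congrArg Subtype.val h)) ?_
        rw [bilin_apply, form₂_single hH]
        exact split₁_single_pos pos hF hG hH hK hHK) H.1 H.2 K.1 K.2
    simpa using this
  · intro x
    have h3 : (0 : ℝ) < r G - r F - 3 := by linarith
    rw [bilin_apply]
    refine le_of_mul_le_mul_left (a := (r G - r F - 3 : ℝ)) ?_ h3
    rw [base_form₂_eq hr hF, Finset.mul_sum, ← Finset.sum_coe_sort]
    refine Finset.sum_le_sum fun H _ => ?_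
    rw [bilin_apply, bilin_apply, form₂_single H.2, form₂_single H.2,
      split₁_base_eta hr ε hF H.2, ← mul_div_assoc, le_div_iff₀
        (mul_pos (by linarith) (bpos H.1 H.2))]
    have := mul_le_mul_of_nonneg_left (ih x H.1 H.2) (cpos H.1 H.2).le
    simp only [b]
    linarith

include hr hε in
theorem base_strong : ∀ n, ∀ F ∈ flats r, ∀ G ∈ flats r, F ⊂ G → r G ≤ r F + n →
    ∀ u : Finset α → ℝ,
    (r G - r F - 1 : ℝ) * form₂ (flats r) (base (flats r) r ε) F G u u * base (flats r) r ε F G ≤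
      (r G - r F - 2) * form₁ (flats r) (base (flats r) r ε) F G u ^ 2 := by
  intro n
  induction n with
  | zero =>
    intro F hF G hG hFG h
    have := hr.lt_of_ssubset hF hFG
    omega
  | succ n ih =>
    intro F hF G hG hFG h u
    have hlt := hr.lt_of_ssubset hF hFG
    rcases Nat.lt_or_ge (r G) (r F + 3) with h3 | h3
    · rw [form₂_eq_zero_of_le hr hF (by omega), mul_zero, zero_mul]
      rcases Nat.lt_or_ge (r G) (r F + 2) with h2 | h2
      · rw [(form_eq_zero_of_le hr hF (by omega) _ u u).1]; simp
      · have : (r G : ℝ) = r F + 2 := by exact_mod_cast (by omega : r G = r F + 2)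
        rw [this]; simp
    · have h3' : (r F + 3 : ℝ) ≤ r G := by exact_mod_cast h3
      have hb := base_pos hr hε F hF G hG hFG
      have eA : form₂ (flats r) (base (flats r) r ε) F G (eta ε) (eta ε) =
          (r G - r F - 2) * ((r G - r F - 1) * base (flats r) r ε F G) := by
        rw [form₂_base_eta hr ε hF, form₁_base_eta hr ε hF hFG]
      have hpos : 0 < form₂ (flats r) (base (flats r) r ε) F G (eta ε) (eta ε) := by
        rw [eA]
        exact mul_pos (by linarith) (mul_pos (by linarith) hb)
      have ihsplit : ∀ u, ∀ H ∈ between (flats r) F G,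
          (r G - r F - 2 : ℝ) * split₂ (flats r) (base (flats r) r ε) F H G u u *
            (base (flats r) r ε F H * base (flats r) r ε H G) ≤
            (r G - r F - 3) * split₁ (flats r) (base (flats r) r ε) F H G u ^ 2 := by
        intro u H hH
        have hH' := mem_between.mp hH
        have l1 := hr.lt_of_ssubset hF hH'.2.1
        have l2 := hr.lt_of_ssubset hH'.1 hH'.2.2
        exact split₂_strong hr hF hH u (ih F hF H hH'.1 hH'.2.1 (by omega) u)
          (ih H hH'.1 G hG hH'.2.2 (by omega) u)
      have key := sq_ge_of_bochner (bilin (flats r) (base (flats r) r ε) F G) form₂_symm (eta ε)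
        hpos (fun x hx => ?_) u
      · rw [bilin_apply, bilin_apply, bilin_apply, eA, form₂_symm (eta ε),
          form₂_base_eta hr ε hF] at key
        refine le_of_mul_le_mul_left (a := (r G - r F - 2 : ℝ)) ?_ (by linarith)
        linarith
      · rcases Nat.lt_or_ge (r G) (r F + 4) with h4 | h4
        · exact base_form₂_nonpos_of_eq hr hF hG hFG (by omega) hpos x hx
        · exact base_form₂_nonpos hr hε hF hG h4 ihsplit x hx

include hr hε in
theorem base_sq_ge (hF : F ∈ flats r) (hG : G ∈ flats r) (hFG : F ⊂ G) (u : Finset α → ℝ) :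
    form₂ (flats r) (base (flats r) r ε) F G u u * base (flats r) r ε F G ≤
      form₁ (flats r) (base (flats r) r ε) F G u ^ 2 := by
  have hlt := hr.lt_of_ssubset hF hFG
  rcases Nat.lt_or_ge (r G) (r F + 2) with h2 | h2
  · rw [(form_eq_zero_of_le hr hF (by omega) _ u u).2, zero_mul]
    exact sq_nonneg _
  · have h2' : (r F + 2 : ℝ) ≤ r G := by exact_mod_cast h2
    have := base_strong hr hε (r G) F hF G hG hFG (by omega) u
    refine le_of_mul_le_mul_left (a := (r G - r F - 1 : ℝ)) ?_ (by linarith)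
    nlinarith [sq_nonneg (form₁ (flats r) (base (flats r) r ε) F G u)]

end

section

variable {α : Type*}

section step

variable {F G : Finset α} {U : Set (Finset α)} {i : α}

/-- The difference between the indicator functions of a principal filter and of `U`. -/
noncomputable def gap (U : Set (Finset α)) (i : α) : Finset α → ℝ :=
  ind {H | i ∈ H} + (-1 : ℝ) • ind U

theorem gap_nonneg (hUi : ∀ H ∈ U, i ∈ H) (H : Finset α) : 0 ≤ gap U i H := by
  by_cases h : H ∈ U
  · simp [gap, ind, h, hUi H h]
  · by_cases hi : i ∈ H <;> simp [gap, ind, h, hi]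

theorem ind_eq_sub_gap : ind U = ind {H | i ∈ H} + (-1 : ℝ) • gap U i := by
  simp only [gap]; module

theorem dev_gap (hUi : ∀ H ∈ U, i ∈ H) (hG : G ∈ U) (hF : i ∉ F) (H : Finset α) :
    dev F G (gap U i) H = gap U i H := by
  apply dev_of_ends
  · have : F ∉ U := fun h => hF (hUi F h)
    simp [gap, ind, this, hF]
  · simp [gap, ind, hG, hUi G hG]

variable [DecidableEq α] {L : Finset (Finset α)} {b : Finset α → Finset α → ℝ}

/-- The extension of `form₂` by one dimension, coupled through `form₁`. -/
noncomputable def extBilin (L : Finset (Finset α)) (b : Finset α → Finset α → ℝ)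
    (F G : Finset α) :
    (Finset α → ℝ) × ℝ →ₗ[ℝ] (Finset α → ℝ) × ℝ →ₗ[ℝ] ℝ :=
  LinearMap.mk₂ ℝ (fun x y => form₂ L b F G x.1 y.1 + x.2 * form₁ L b F G y.1
      + y.2 * form₁ L b F G x.1 + x.2 * y.2 * b F G)
    (fun x x' y => by simp only [Prod.fst_add, Prod.snd_add, form₂_add_left, form₁_add]; ring)
    (fun a x y => by
      simp only [Prod.smul_fst, Prod.smul_snd, form₂_smul_left, form₁_smul, smul_eq_mul]; ring)
    (fun x y y' => by simp only [Prod.fst_add, Prod.snd_add, form₂_add_right, form₁_add]; ring)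
    (fun a x y => by
      simp only [Prod.smul_fst, Prod.smul_snd, form₂_smul_right, form₁_smul, smul_eq_mul]; ring)

theorem extBilin_apply (x y : (Finset α → ℝ) × ℝ) :
    extBilin L b F G x y = form₂ L b F G x.1 y.1 + x.2 * form₁ L b F G y.1
      + y.2 * form₁ L b F G x.1 + x.2 * y.2 * b F G := rfl

theorem extBilin_symm (x y : (Finset α → ℝ) × ℝ) :
    extBilin L b F G x y = extBilin L b F G y x := by
  simp only [extBilin_apply]; rw [form₂_symm]; ring

theorem split₂_sq_ge {H : Finset α} (u : Finset α → ℝ)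
    (k₁ : form₂ L b F H u u * b F H ≤ form₁ L b F H u ^ 2)
    (k₂ : form₂ L b H G u u * b H G ≤ form₁ L b H G u ^ 2) :
    split₂ L b F H G u u * (b F H * b H G) ≤ split₁ L b F H G u ^ 2 := by
  rw [split₂, split₁]
  have := mul_le_mul_of_nonneg_right k₁ (sq_nonneg (b H G))
  have := mul_le_mul_of_nonneg_right k₂ (sq_nonneg (b F H))
  linarith

theorem sq_add_le_div {A X b s : ℝ} (hb : 0 < b) (h : A * b ≤ X ^ 2) :
    A + 2 * s * X + s ^ 2 * b ≤ (X + s * b) ^ 2 / b := by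
  rw [le_div_iff₀ hb]; linarith

variable (hU : IsUpperSet U) (hUi : ∀ H ∈ U, i ∈ H) (hb : Balanced L b) (hF : F ∈ L)
  (hG : G ∈ L) (hFG : F ⊂ G) (hGU : G ∈ U) (hiF : i ∉ F)

include hUi hb hF hG hFG hGU hiF in
theorem eq_modify_add :
    b F G = modify L U b F G + ∑ H ∈ between L F G, gap U i H * (b F H * b H G) := by
  have h1 : form₁ L b F G (gap U i) = ∑ H ∈ between L F G, gap U i H * (b F H * b H G) :=
    Finset.sum_congr rfl fun H _ => by rw [dev_gap hUi hGU hiF]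
  rw [modify, ind_eq_sub_gap (i := i), form₁_add, form₁_smul, ind_mem_eq_lin, hb F hF G hG hFG, h1]
  ring

include hU hUi hb hF hG hGU hiF in
theorem form₁_eq_modify_add (u : Finset α → ℝ) :
    form₁ L b F G u = form₁ L (modify L U b) F G u +
      ∑ H ∈ between L F G, gap U i H * split₁ L b F H G u := by
  have h1 : form₂ L b F G (gap U i) u = ∑ H ∈ between L F G, gap U i H * split₁ L b F H G u :=
    Finset.sum_congr rfl fun H _ => by rw [dev_gap hUi hGU hiF]
  rw [form₁_modify hU, form₂_symm, ind_eq_sub_gap (i := i), form₂_add_left, form₂_smul_left,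
    ind_mem_eq_lin, hb.form₂_lin_left hF hG, h1]
  ring

include hU hUi hb hF hG hGU hiF in
theorem form₂_eq_modify_add (u w : Finset α → ℝ) :
    form₂ L b F G u w = form₂ L (modify L U b) F G u w +
      ∑ H ∈ between L F G, gap U i H * split₂ L b F H G u w := by
  rw [form₂_modify hU]
  have h1 : form₃ L b F G (ind U) u w = - ∑ H ∈ between L F G, gap U i H * split₂ L b F H G u w := by
    have h2 : form₃ L b F G (lin fun j => if j = i then 1 else 0) u w = 0 := by
      rw [form₃_symm_left, form₃_symm_right]
      exact Finset.sum_eq_zero fun H hH => by rw [hb.split₂_lin hF hG hH, mul_zero]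
    rw [← ind_mem_eq_lin, form₃] at h2
    rw [form₃, ← zero_sub, ← h2, ← Finset.sum_sub_distrib]
    refine Finset.sum_congr rfl fun H _ => ?_
    rw [ind_eq_sub_gap (U := U) (i := i), dev_add, dev_smul, dev_gap hUi hGU hiF]
    ring
  rw [h1]; ring

include hU hUi hb hF hG hFG hGU hiF in
theorem sq_ge_of_modify (pos : ∀ F ∈ L, ∀ G ∈ L, F ⊂ G → 0 < b F G)
    (pos' : ∀ F ∈ L, ∀ G ∈ L, F ⊂ G → 0 < modify L U b F G)
    (sub : ∀ H ∈ between L F G, ∀ u, form₂ L b F H u u * b F H ≤ form₁ L b F H u ^ 2 ∧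
      form₂ L b H G u u * b H G ≤ form₁ L b H G u ^ 2)
    (ih : ∀ u, form₂ L (modify L U b) F G u u * modify L U b F G ≤
      form₁ L (modify L U b) F G u ^ 2) (u : Finset α → ℝ) :
    form₂ L b F G u u * b F G ≤ form₁ L b F G u ^ 2 := by
  classical
  let s := (between L F G).filter fun H => gap U i H ≠ 0
  have hs : ∀ H ∈ s, H ∈ between L F G := fun H hH => (Finset.mem_filter.mp hH).1
  have sum_s : ∀ f : Finset α → ℝ, ∑ H ∈ between L F G, gap U i H * f H =
      ∑ H : {H // H ∈ s}, gap U i H.1 * f H.1 := by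
    intro f
    rw [Finset.sum_coe_sort s (fun H => gap U i H * f H)]
    exact (Finset.sum_filter_of_ne fun H _ h => left_ne_zero_of_mul h).symm
  have bpos : ∀ H ∈ between L F G, 0 < b F H * b H G := by
    intro H hH
    rw [mem_between] at hH
    exact mul_pos (pos F hF H hH.1 hH.2.1) (pos H hH.1 G hG hH.2.2)
  have bpos' : ∀ H ∈ between L F G, 0 < modify L U b F H * modify L U b H G := by
    intro H hH
    rw [mem_between] at hH
    exact mul_pos (pos' F hF H hH.1 hH.2.1) (pos' H hH.1 G hG hH.2.2)
  let D : Option {H // H ∈ s} → (Finset α → ℝ) × ℝ := fun o =>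
    o.elim ((-1 : ℝ) • gap U i, 1) fun H => (Pi.single H.1 1, 0)
  have e₀ : ∀ y, extBilin L b F G (D none) y =
      form₁ L (modify L U b) F G y.1 + y.2 * modify L U b F G := by
    intro y
    have h1 := form₁_eq_modify_add hU hUi hb hF hG hGU hiF y.1
    have h2 := eq_modify_add hUi hb hF hG hFG hGU hiF
    have h3 : form₁ L b F G (gap U i) = ∑ H ∈ between L F G, gap U i H * (b F H * b H G) :=
      Finset.sum_congr rfl fun H _ => by rw [dev_gap hUi hGU hiF]
    have h4 : form₂ L b F G (gap U i) y.1 =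
        ∑ H ∈ between L F G, gap U i H * split₁ L b F H G y.1 :=
      Finset.sum_congr rfl fun H _ => by rw [dev_gap hUi hGU hiF]
    simp only [D, Option.elim_none, extBilin_apply, form₂_smul_left, form₁_smul, h3, h4]
    rw [h1, h2]
    ring
  have e₁ : ∀ (H : {H // H ∈ s}) y, extBilin L b F G (D (some H)) y =
      split₁ L b F H.1 G y.1 + y.2 * (b F H.1 * b H.1 G) := by
    intro H y
    have h := hs H.1 H.2
    have h' := mem_between.mp h
    simp only [D, Option.elim_some, extBilin_apply, form₂_single h,
      form₁_single h'.2.1.ne' h'.2.2.ne, if_pos h]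
    ring
  have key := sq_ge_of_bochner (extBilin L b F G) extBilin_symm (0, 1)
    (by simpa [extBilin_apply, form₁, form₂, dev] using pos F hF G hG hFG) (fun x hx => ?_) (u, 0)
  · simpa [extBilin_apply, form₁, form₂, dev] using key
  · refine bochner (extBilin L b F G) extBilin_symm D (0, 1)
      (fun o => o.elim 1 fun H => gap U i H.1) ?_ ?_ ?_ ?_ ?_ ?_ x hx
    · rintro (_ | H)
      · exact one_pos
      · exact lt_of_le_of_ne (gap_nonneg hUi _) (Finset.mem_filter.mp H.2).2.symm
    · intro y
      simp only [Fintype.sum_option, Option.elim_none, Option.elim_some, e₀, e₁, mul_add,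
        Finset.sum_add_distrib, one_mul]
      have h2 := eq_modify_add hUi hb hF hG hFG hGU hiF
      rw [sum_s] at h2
      have h1 := form₁_eq_modify_add hU hUi hb hF hG hGU hiF y.1
      rw [sum_s] at h1
      have h0 : extBilin L b F G (0, 1) y = form₁ L b F G y.1 + y.2 * b F G := by
        simp [extBilin_apply, form₁, form₂, dev]
      rw [h0, h1, h2, mul_add, Finset.mul_sum]
      have : ∀ H : {H // H ∈ s}, y.2 * (gap U i H.1 * (b F H.1 * b H.1 G)) =
        gap U i H.1 * (y.2 * (b F H.1 * b H.1 G)) := fun H => by ring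
      simp only [this]
      ring
    · rintro (_ | H)
      · rw [e₀]
        simpa [form₁, dev] using pos' F hF G hG hFG
      · rw [e₁]
        simpa [split₁, form₁, dev] using bpos H.1 (hs _ H.2)
    · have hstar : ∀ H : {H // H ∈ s}, 0 ≤ extBilin L b F G (D none) (D (some H)) := by
        intro H
        have h := hs H.1 H.2
        have h' := mem_between.mp h
        rw [e₀]
        simp only [D, Option.elim_some, form₁_single h'.2.1.ne' h'.2.2.ne, if_pos h]
        simpa using (bpos' H.1 h).le
      rintro (_ | H) (_ | K) hne
      · exact absurd rfl hne
      · exact hstar K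
      · rw [extBilin_symm]; exact hstar H
      · rw [e₁]
        simp only [D, Option.elim_some, zero_mul, add_zero]
        exact split₁_single_nonneg pos hF hG (hs _ H.2) (hs _ K.2) fun h =>
          hne (congrArg some (Subtype.ext h))
    · intro y hy
      have hstar : ∀ H, y none = y (some H) := by
        intro H
        refine hy _ _ (by simp) ?_
        have h := hs H.1 H.2
        have h' := mem_between.mp h
        rw [e₀]
        simp only [D, Option.elim_some, form₁_single h'.2.1.ne' h'.2.2.ne, if_pos h]
        simpa using bpos' H.1 h
      have hall : ∀ o, y none = y o := by rintro (_ | H); exacts [rfl, hstar H]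
      intro o o'
      rw [← hall o, ← hall o']
    · intro x
      have e2 : extBilin L b F G (D none) (0, 1) = modify L U b F G := by
        rw [e₀]; simp [form₁, dev]
      have e3 : ∀ H, extBilin L b F G (D (some H)) (0, 1) = b F H.1 * b H.1 G := by
        intro H; rw [e₁]; simp [split₁, form₁, dev]
      simp only [Fintype.sum_option, Option.elim_none, Option.elim_some, e2, e3]
      simp only [e₀, e₁, one_mul]
      have h0 : extBilin L b F G x x = form₂ L b F G x.1 x.1 + 2 * x.2 * form₁ L b F G x.1 +
          x.2 ^ 2 * b F G := by
        rw [extBilin_apply]; ring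
      have h1 : extBilin L b F G x x = (form₂ L (modify L U b) F G x.1 x.1 +
          2 * x.2 * form₁ L (modify L U b) F G x.1 + x.2 ^ 2 * modify L U b F G) +
          ∑ H : {H // H ∈ s}, gap U i H.1 * (split₂ L b F H.1 G x.1 x.1 +
            2 * x.2 * split₁ L b F H.1 G x.1 + x.2 ^ 2 * (b F H.1 * b H.1 G)) := by
        rw [h0, form₂_eq_modify_add hU hUi hb hF hG hGU hiF,
          form₁_eq_modify_add hU hUi hb hF hG hGU hiF, eq_modify_add hUi hb hF hG hFG hGU hiF,
          sum_s, sum_s, sum_s]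
        simp only [mul_add, Finset.sum_add_distrib, Finset.mul_sum]
        have t1 : ∀ H : {H // H ∈ s}, gap U i H.1 * (2 * x.2 * split₁ L b F H.1 G x.1) =
          2 * x.2 * (gap U i H.1 * split₁ L b F H.1 G x.1) := fun H => by ring
        have t2 : ∀ H : {H // H ∈ s}, gap U i H.1 * (x.2 ^ 2 * (b F H.1 * b H.1 G)) =
          x.2 ^ 2 * (gap U i H.1 * (b F H.1 * b H.1 G)) := fun H => by ring
        simp only [t1, t2]
        ring
      rw [h1]
      refine add_le_add (sq_add_le_div (pos' F hF G hG hFG) (ih x.1)) ?_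
      refine Finset.sum_le_sum fun H _ => ?_
      have hH := hs H.1 H.2
      have hH' := mem_between.mp hH
      rw [mul_div_assoc]
      exact mul_le_mul_of_nonneg_left (sq_add_le_div (bpos H.1 hH) (split₂_sq_ge x.1 (sub _ hH x.1).1
        (sub _ hH x.1).2)) (gap_nonneg hUi _)

end step

end

section

variable {α : Type*} [DecidableEq α]

section sys

variable {L : Finset (Finset α)} {b b' : Finset α → Finset α → ℝ} {F G : Finset α}

theorem form₁_congr (hF : F ∈ L) (hG : G ∈ L)
    (h : ∀ F' ∈ L, ∀ G' ∈ L, F ⊆ F' → F' ⊂ G' → G' ⊆ G → b F' G' = b' F' G')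
    (u : Finset α → ℝ) : form₁ L b F G u = form₁ L b' F G u := by
  refine Finset.sum_congr rfl fun H hH => ?_
  rw [mem_between] at hH
  rw [h F hF H hH.1 subset_rfl hH.2.1 hH.2.2.subset, h H hH.1 G hG hH.2.1.subset hH.2.2 subset_rfl]

theorem form₂_congr (hF : F ∈ L) (hG : G ∈ L)
    (h : ∀ F' ∈ L, ∀ G' ∈ L, F ⊆ F' → F' ⊂ G' → G' ⊆ G → b F' G' = b' F' G')
    (u w : Finset α → ℝ) : form₂ L b F G u w = form₂ L b' F G u w := by
  refine Finset.sum_congr rfl fun H hH => ?_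
  rw [mem_between] at hH
  rw [split₁, split₁, h F hF H hH.1 subset_rfl hH.2.1 hH.2.2.subset,
    h H hH.1 G hG hH.2.1.subset hH.2.2 subset_rfl,
    form₁_congr hF hH.1 fun F' hF' G' hG' h1 h2 h3 =>
      h F' hF' G' hG' h1 h2 (h3.trans hH.2.2.subset),
    form₁_congr hH.1 hG fun F' hF' G' hG' h1 h2 h3 =>
      h F' hF' G' hG' (hH.2.1.subset.trans h1) h2 h3]

theorem modify_of_trivial {U : Set (Finset α)} (hU : IsUpperSet U) (h : F ∈ U ∨ G ∉ U) :
    modify L U b F G = b F G := by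
  rw [modify, form₁_eq_zero (dev_ind_eq_zero hU h), add_zero]

theorem modify_empty : modify L ∅ b = b := by
  funext F G
  exact modify_of_trivial isUpperSet_empty (.inr (Set.notMem_empty G))

/-- The super-level sets of a function. -/
def level (ρ : Finset α → ℕ) (a : ℕ) : Set (Finset α) := {H | a ≤ ρ H}

omit [DecidableEq α] in
theorem isUpperSet_level {ρ : Finset α → ℕ} (hρ : Monotone ρ) (a : ℕ) :
    IsUpperSet (level ρ a) := fun _ _ h (ha : a ≤ _) => ha.trans (hρ h)

/-- The successive modification of `b` along `n` levels of `ρ`, starting at `a`. -/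
noncomputable def tower (L : Finset (Finset α)) (ρ : Finset α → ℕ)
    (b : Finset α → Finset α → ℝ) : ℕ → ℕ → Finset α → Finset α → ℝ
  | _, 0 => b
  | a, n + 1 => modify L (level ρ a) (tower L ρ b (a + 1) n)

theorem modify_tower {ρ ρ' : Finset α → ℕ} (hρ : Monotone ρ) {U : Set (Finset α)}
    (hU : IsUpperSet U) (h : ∀ H, ρ' H = ρ H + U.indicator 1 H) (n a : ℕ) :
    modify L (U ∩ level ρ a) (tower L ρ b (a + 1) n) =
      tower L ρ' (modify L (U ∩ level ρ (a + n)) b) (a + 1) n := by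
  induction n generalizing a with
  | zero => rfl
  | succ n ih =>
    rw [tower, tower, modify_modify (hU.inter (isUpperSet_level hρ a))
      (isUpperSet_level hρ (a + 1)), ← show a + 1 + n = a + (n + 1) by ring, ← ih (a + 1)]
    congr 2
    · ext H
      by_cases hH : H ∈ U
      · simp [level, hH, h]; omega
      · simp [level, hH, h]
    · rw [Set.inter_assoc]
      congr 1
      ext H
      simp [level]; omega

theorem Balanced.tower (hb : Balanced L b) {ρ : Finset α → ℕ} (hρ : Monotone ρ) (n a : ℕ) :
    Balanced L (tower L ρ b a n) := by
  induction n generalizing a with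
  | zero => exact hb
  | succ n ih => exact (ih (a + 1)).modify (isUpperSet_level hρ a)

variable [Fintype α]

/-- The modification of the system `b` along all the levels of `ρ`. -/
noncomputable def sys (L : Finset (Finset α)) (ρ : Finset α → ℕ)
    (b : Finset α → Finset α → ℝ) : Finset α → Finset α → ℝ :=
  tower L ρ b 1 (Fintype.card α + 1)

theorem Balanced.sys (hb : Balanced L b) {ρ : Finset α → ℕ} (hρ : Monotone ρ) :
    Balanced L (sys L ρ b) := hb.tower hρ _ _

theorem sys_eq_modify {ρ ρ' : Finset α → ℕ} (hρ : Monotone ρ)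
    (hle : ∀ H, ρ H ≤ Fintype.card α) {U : Set (Finset α)} (hU : IsUpperSet U)
    (h : ∀ H, ρ' H = ρ H + U.indicator 1 H) : sys L ρ' b = modify L U (sys L ρ b) := by
  have h1 := modify_tower (L := L) (b := b) hρ hU h (Fintype.card α + 1) 0
  have h2 : level ρ 0 = Set.univ := Set.eq_univ_of_forall fun H => Nat.zero_le _
  have h3 : level ρ (0 + (Fintype.card α + 1)) = ∅ :=
    Set.eq_empty_of_forall_notMem fun H (hH : _ ≤ ρ H) => by have := hle H; omega
  rw [h2, h3, Set.inter_univ, Set.inter_empty, modify_empty] at h1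
  exact h1.symm

theorem sys_zero : sys L (fun _ => 0) b = b := by
  have : ∀ n a, 0 < a → tower L (fun _ => 0) b a n = b := by
    intro n
    induction n with
    | zero => exact fun _ _ => rfl
    | succ n ih =>
      intro a ha
      have h : level (fun _ : Finset α => 0) a = ∅ :=
        Set.eq_empty_of_forall_notMem fun H (hH : a ≤ 0) => by omega
      rw [tower, ih _ (Nat.succ_pos a), h, modify_empty]
  exact this _ _ one_pos

theorem sys_card (hb : Balanced L b) (hF : F ∈ L) (hG : G ∈ L) (hFG : F ⊂ G) :
    sys L Finset.card b F G = b F G := by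
  have mono : ∀ S : Finset α, Monotone fun H : Finset α => (H ∩ S).card := fun S _ _ h =>
    Finset.card_le_card (Finset.inter_subset_inter_right h)
  have key : ∀ S : Finset α, sys L (fun H => (H ∩ S).card) b F G = b F G := by
    intro S
    induction S using Finset.induction_on with
    | empty => simp [sys_zero]
    | insert i S hi ih =>
      rw [sys_eq_modify (mono S) (fun H => Finset.card_le_univ _) (U := {H | i ∈ H})
        (fun _ _ h h' => h h'), modify, ind_mem_eq_lin, hb.sys (mono S) F hF G hG hFG, add_zero, ih]
      intro H
      by_cases h : i ∈ H
      · simp [h, Finset.inter_insert_of_mem, hi]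
      · simp [h, Finset.inter_insert_of_notMem]
  simpa using key Finset.univ

end sys

section induction

variable {ρ : Finset α → ℕ} {i : α}

/-- The function obtained from a rank function by making `i` a coloop. -/
def freed (ρ : Finset α → ℕ) (i : α) (H : Finset α) : ℕ := ρ (H.erase i) + if i ∈ H then 1 else 0

/-- The sets containing `i` in which `i` is not a coloop. -/
def redundant (ρ : Finset α → ℕ) (i : α) : Set (Finset α) := {H | i ∈ H ∧ ρ (H.erase i) = ρ H}

theorem IsRank.freed_eq (hρ : IsRank ρ) (H : Finset α) :
    freed ρ i H = ρ H + (redundant ρ i).indicator 1 H := by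
  by_cases hi : i ∈ H
  · have h1 := hρ.insert_le i (H.erase i)
    have h2 := hρ.mono (H.erase_subset i)
    rw [Finset.insert_erase hi] at h1
    by_cases h : ρ (H.erase i) = ρ H
    · simp [freed, redundant, hi, h]
    · simp [freed, redundant, hi, h]; omega
  · simp [freed, redundant, hi]

theorem IsRank.isUpperSet_redundant (hρ : IsRank ρ) : IsUpperSet (redundant ρ i) := by
  rintro H K h ⟨hi, hH⟩
  refine ⟨h hi, ?_⟩
  have := hρ.insert_eq_of_subset (Finset.erase_subset_erase i h) (i := i)
    (by rw [Finset.insert_erase hi, hH])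
  rwa [Finset.insert_erase (h hi), eq_comm] at this

theorem IsRank.freed (hρ : IsRank ρ) (i : α) : IsRank (freed ρ i) where
  empty := by simp [BrokenCircuit.freed, hρ.empty]
  mono H K h := by
    have h1 := hρ.mono (Finset.erase_subset_erase i h)
    have h2 := @h i
    simp only [BrokenCircuit.freed]
    split_ifs <;> first | omega | tauto
  insert_le j S := by
    simp only [BrokenCircuit.freed]
    by_cases h : j = i
    · subst h
      simp only [Finset.erase_insert_eq_erase, Finset.mem_insert_self, if_true]
      omega
    · rw [Finset.erase_insert_of_ne h]
      have := hρ.insert_le j (S.erase i)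
      simp only [Finset.mem_insert, Ne.symm h, false_or]
      omega
  submod S T := by
    have h₁ := hρ.submod (S.erase i) (T.erase i)
    have h₂ : S.erase i ∩ T.erase i = (S ∩ T).erase i := by
      ext x; simp only [Finset.mem_inter, Finset.mem_erase]; tauto
    rw [← Finset.erase_union_distrib, h₂] at h₁
    simp only [BrokenCircuit.freed, Finset.mem_union, Finset.mem_inter]
    by_cases h : i ∈ S <;> by_cases h' : i ∈ T <;>
      simp only [h, h', or_true, or_false, and_true, and_false, if_true, if_false] <;>
      omega

theorem IsRank.sdiff_add_card_le (hρ : IsRank ρ) {G T : Finset α}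
    (h : ∀ j ∈ T, ρ (G.erase j) < ρ G) : ρ (G \ T) + T.card ≤ ρ G := by
  induction T using Finset.induction_on with
  | empty => simp
  | insert j T hj ih =>
    have h1 := ih fun k hk => h k (Finset.mem_insert_of_mem hk)
    have h2 := h j (Finset.mem_insert_self j T)
    have h3 := hρ.submod (G \ T) (G.erase j)
    have h4 : G \ T ∪ G.erase j = G := by
      ext x
      simp only [Finset.mem_union, Finset.mem_sdiff, Finset.mem_erase]
      by_cases hx : x = j
      · subst hx; tauto
      · tauto
    have h5 : G \ T ∩ G.erase j = G \ insert j T := by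
      ext x
      simp only [Finset.mem_inter, Finset.mem_sdiff, Finset.mem_erase, Finset.mem_insert]
      tauto
    rw [h4, h5] at h3
    rw [Finset.card_insert_of_notMem hj]
    omega

theorem IsRank.le_card (hρ : IsRank ρ) (S : Finset α) : ρ S ≤ S.card := by
  have := hρ.le_add_card ∅ S
  rwa [Finset.empty_union, hρ.empty, zero_add] at this

theorem IsRank.trivial_of_coloops (hρ : IsRank ρ) {F G : Finset α} (hFG : F ⊂ G)
    (h : ∀ j ∈ G \ F, ρ (G.erase j) < ρ G) : F ∈ redundant ρ i ∨ G ∉ redundant ρ i := by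
  by_cases hG : G ∈ redundant ρ i
  · left
    have hiF : i ∈ F := by
      by_contra hiF
      exact (h i (Finset.mem_sdiff.mpr ⟨hG.1, hiF⟩)).ne hG.2
    refine ⟨hiF, le_antisymm (hρ.mono (F.erase_subset i)) ?_⟩
    have h1 := hρ.sdiff_add_card_le h
    rw [Finset.sdiff_sdiff_eq_self hFG.subset] at h1
    have h2 := hρ.le_add_card (F.erase i) (G \ F)
    have h3 : F.erase i ∪ G \ F = G.erase i := by
      ext x
      have : x ∈ F → x ∈ G := fun h => hFG.subset h
      simp only [Finset.mem_union, Finset.mem_sdiff, Finset.mem_erase]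
      by_cases hx : x = i
      · subst hx; tauto
      · tauto
    rw [h3, hG.2] at h2
    omega
  · exact .inr hG

variable [Fintype α]

theorem IsRank.eq_card (hρ : IsRank ρ) (h : ∀ i, ρ (Finset.univ.erase i) < ρ Finset.univ) :
    ρ = Finset.card := by
  funext S
  have h1 := hρ.sdiff_add_card_le (G := Finset.univ) (T := Finset.univ) fun j _ => h j
  have h2 := hρ.le_add_card S Sᶜ
  rw [Finset.union_compl] at h2
  have h3 := Finset.card_add_card_compl S
  have h4 := hρ.le_card S
  rw [Finset.card_univ] at h1
  omega

theorem rank_induction {L : Finset (Finset α)} {P : (Finset α → ℕ) → Finset α → Finset α → Prop}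
    (card : ∀ F ∈ L, ∀ G ∈ L, F ⊂ G → P Finset.card F G)
    (trivial : ∀ ρ, IsRank ρ → ∀ i, ∀ F ∈ L, ∀ G ∈ L, F ⊂ G →
      (F ∈ redundant ρ i ∨ G ∉ redundant ρ i) → P (freed ρ i) F G → P ρ F G)
    (step : ∀ ρ, IsRank ρ → ∀ i, ∀ F ∈ L, ∀ G ∈ L, F ⊂ G → G ∈ redundant ρ i → i ∉ F →
      (∀ H ∈ between L F G, P ρ F H ∧ P ρ H G) → P (freed ρ i) F G → P ρ F G)
    (hρ : IsRank ρ) : ∀ F ∈ L, ∀ G ∈ L, F ⊂ G → P ρ F G := by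
  have key : ∀ n m, ∀ ρ, IsRank ρ → ∀ F ∈ L, ∀ G ∈ L, F ⊂ G → G.card ≤ F.card + n →
      Fintype.card α ≤ ρ Finset.univ + m → P ρ F G := by
    intro n
    induction n with
    | zero =>
      intro m ρ hρ F hF G hG hFG h
      have := Finset.card_lt_card hFG
      omega
    | succ n ih =>
      intro m
      induction m with
      | zero =>
        intro ρ hρ F hF G hG hFG _ h
        rw [hρ.eq_card]
        · exact card F hF G hG hFG
        · intro i
          have h1 := hρ.le_card (Finset.univ.erase i)
          have h2 := Finset.card_erase_lt_of_mem (Finset.mem_univ i)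
          rw [Finset.card_univ] at h2
          omega
      | succ m ihm =>
        intro ρ hρ F hF G hG hFG h hm
        have next : ∀ i, Finset.univ ∈ redundant ρ i → P (freed ρ i) F G := by
          intro i hi
          refine ihm _ (hρ.freed i) F hF G hG hFG h ?_
          rw [hρ.freed_eq, Set.indicator_of_mem hi]
          simp only [Pi.one_apply]
          omega
        by_cases hA : ∃ i ∈ G \ F, ρ (G.erase i) = ρ G
        · obtain ⟨i, hi, hGi⟩ := hA
          rw [Finset.mem_sdiff] at hi
          have hGU : G ∈ redundant ρ i := ⟨hi.1, hGi⟩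
          refine step ρ hρ i F hF G hG hFG hGU hi.2 (fun H hH => ?_)
            (next i (hρ.isUpperSet_redundant (Finset.subset_univ G) hGU))
          rw [mem_between] at hH
          have h1 := Finset.card_lt_card hH.2.1
          have h2 := Finset.card_lt_card hH.2.2
          exact ⟨ih (m + 1) ρ hρ F hF H hH.1 hH.2.1 (by omega) hm,
            ih (m + 1) ρ hρ H hH.1 G hG hH.2.2 (by omega) hm⟩
        · push Not at hA
          by_cases hB : ∃ i, ρ (Finset.univ.erase i) = ρ Finset.univ
          · obtain ⟨i, hi⟩ := hB
            exact trivial ρ hρ i F hF G hG hFG (hρ.trivial_of_coloops hFG fun j hj =>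
              lt_of_le_of_ne (hρ.mono (G.erase_subset j)) (hA j hj))
              (next i ⟨Finset.mem_univ i, hi⟩)
          · push Not at hB
            rw [hρ.eq_card fun i => lt_of_le_of_ne (hρ.mono (Finset.erase_subset i _)) (hB i)]
            exact card F hF G hG hFG
  exact fun F hF G hG hFG => key G.card (Fintype.card α) ρ hρ F hF G hG hFG (by omega) (by omega)

variable {L : Finset (Finset α)} {b : Finset α → Finset α → ℝ}

theorem IsRank.sys_freed (hρ : IsRank ρ) (i : α) :
    sys L (BrokenCircuit.freed ρ i) b = modify L (redundant ρ i) (sys L ρ b) :=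
  sys_eq_modify hρ.mono (fun H => (hρ.le_card H).trans (Finset.card_le_univ H))
    hρ.isUpperSet_redundant fun H => hρ.freed_eq H

theorem sys_pos (hb : Balanced L b) (pos : ∀ F ∈ L, ∀ G ∈ L, F ⊂ G → 0 < b F G)
    (hρ : IsRank ρ) : ∀ F ∈ L, ∀ G ∈ L, F ⊂ G → 0 < sys L ρ b F G := by
  refine rank_induction (P := fun ρ F G => 0 < sys L ρ b F G) ?_ ?_ ?_ hρ
  · intro F hF G hG hFG
    rw [sys_card hb hF hG hFG]
    exact pos F hF G hG hFG
  · intro ρ hρ i F hF G hG hFG h hP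
    rwa [hρ.sys_freed, modify_of_trivial hρ.isUpperSet_redundant h] at hP
  · intro ρ hρ i F hF G hG hFG hGU hiF ih hP
    rw [hρ.sys_freed] at hP
    rw [eq_modify_add (fun _ h => h.1) (hb.sys hρ.mono) hF hG hFG hGU hiF]
    exact add_pos_of_pos_of_nonneg hP (Finset.sum_nonneg fun H hH =>
      mul_nonneg (gap_nonneg (fun _ h => h.1) H) (mul_pos (ih H hH).1 (ih H hH).2).le)

theorem sys_sq_ge (hb : Balanced L b) (pos : ∀ F ∈ L, ∀ G ∈ L, F ⊂ G → 0 < b F G)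
    (hsq : ∀ F ∈ L, ∀ G ∈ L, F ⊂ G → ∀ u, form₂ L b F G u u * b F G ≤ form₁ L b F G u ^ 2)
    (hρ : IsRank ρ) : ∀ F ∈ L, ∀ G ∈ L, F ⊂ G → ∀ u,
      form₂ L (sys L ρ b) F G u u * sys L ρ b F G ≤ form₁ L (sys L ρ b) F G u ^ 2 := by
  refine rank_induction (P := fun ρ F G => ∀ u, form₂ L (sys L ρ b) F G u u * sys L ρ b F G ≤
    form₁ L (sys L ρ b) F G u ^ 2) ?_ ?_ ?_ hρ
  · intro F hF G hG hFG u
    have h : ∀ F' ∈ L, ∀ G' ∈ L, F ⊆ F' → F' ⊂ G' → G' ⊆ G →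
        sys L Finset.card b F' G' = b F' G' := fun F' hF' G' hG' _ h _ => sys_card hb hF' hG' h
    rw [form₁_congr hF hG h, form₂_congr hF hG h, sys_card hb hF hG hFG]
    exact hsq F hF G hG hFG u
  · intro ρ hρ i F hF G hG hFG h hP u
    have hU := hρ.isUpperSet_redundant (i := i)
    have h' : ∀ F' ∈ L, ∀ G' ∈ L, F ⊆ F' → F' ⊂ G' → G' ⊆ G →
        sys L ρ b F' G' = sys L (BrokenCircuit.freed ρ i) b F' G' := by
      intro F' _ G' _ h1 _ h2
      rw [hρ.sys_freed, modify_of_trivial hU (h.imp (hU h1) fun hG hG' => hG (hU h2 hG'))]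
    rw [form₁_congr hF hG h', form₂_congr hF hG h', h' F hF G hG subset_rfl hFG subset_rfl]
    exact hP u
  · intro ρ hρ i F hF G hG hFG hGU hiF ih hP u
    refine sq_ge_of_modify hρ.isUpperSet_redundant (fun _ h => h.1) (hb.sys hρ.mono) hF hG hFG hGU
      hiF (sys_pos hb pos hρ) ?_ (fun H hH v => ⟨(ih H hH).1 v, (ih H hH).2 v⟩) ?_ u
    · rw [← hρ.sys_freed]; exact sys_pos hb pos (hρ.freed i)
    · rw [← hρ.sys_freed]; exact hP

end induction

end

section

variable {α : Type*} [DecidableEq α]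

section limit

variable {L : Finset (Finset α)} {b : ℝ → Finset α → Finset α → ℝ}

theorem continuous_form₁ (hb : ∀ F G, Continuous fun ε => b ε F G) (F G : Finset α)
    (u : Finset α → ℝ) : Continuous fun ε => form₁ L (b ε) F G u :=
  continuous_finsetSum _ fun H _ => continuous_const.mul ((hb F H).mul (hb H G))

theorem continuous_form₂ (hb : ∀ F G, Continuous fun ε => b ε F G) (F G : Finset α)
    (u w : Finset α → ℝ) : Continuous fun ε => form₂ L (b ε) F G u w :=
  continuous_finsetSum _ fun H _ => continuous_const.mul
    (((continuous_form₁ hb F H w).mul (hb H G)).add ((hb F H).mul (continuous_form₁ hb H G w)))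

theorem continuous_tower (hb : ∀ F G, Continuous fun ε => b ε F G) (ρ : Finset α → ℕ) (n a : ℕ)
    (F G : Finset α) : Continuous fun ε => tower L ρ (b ε) a n F G := by
  induction n generalizing a F G with
  | zero => exact hb F G
  | succ n ih => exact (ih (a + 1) F G).add (continuous_form₁ (ih (a + 1)) F G _)

theorem continuous_base (r : Finset α → ℕ) (F G : Finset α) :
    Continuous fun ε => base L r ε F G := by
  induction h : G.card - F.card using Nat.strong_induction_on generalizing F G with
  | _ n ih =>
    by_cases hr : r G ≤ r F + 1
    · simp only [base_of_le _ hr]; exact continuous_const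
    · simp only [base_of_lt _ (not_le.mp hr)]
      refine (continuous_id.div_const _).mul (continuous_finsetSum _ fun H hH => ?_)
      rw [mem_between] at hH
      have h1 := Finset.card_lt_card hH.2.1
      have h2 := Finset.card_lt_card hH.2.2
      exact continuous_const.mul ((ih _ (by omega) F H rfl).mul (ih _ (by omega) H G rfl))

/-- The system on the flats of `r` which is supported on the covering pairs. -/
noncomputable def covers (r : Finset α → ℕ) (F G : Finset α) : ℝ := if r G ≤ r F + 1 then 1 else 0

theorem base_zero (r : Finset α → ℕ) : base L r 0 = covers r := by
  funext F G
  by_cases h : r G ≤ r F + 1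
  · rw [base_of_le _ h, covers, if_pos h]
  · rw [base_of_lt _ (not_le.mp h), covers, if_neg h, zero_div, zero_mul]

variable [Fintype α]

/-- The system attached to the flats of `r` and the levels of `ρ`. -/
noncomputable def assoc (r ρ : Finset α → ℕ) : Finset α → Finset α → ℝ :=
  sys (flats r) ρ (covers r)

variable {r ρ : Finset α → ℕ} (hr : IsRank r) (hρ : IsRank ρ) {F G : Finset α}
include hr hρ

theorem assoc_nonneg (hF : F ∈ flats r) (hG : G ∈ flats r) (hFG : F ⊂ G) :
    0 ≤ assoc r ρ F G := by
  have h : Continuous fun ε => sys (flats r) ρ (base (flats r) r ε) F G :=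
    continuous_tower (continuous_base r) ρ _ _ F G
  rw [assoc, ← base_zero (L := flats r)]
  refine ge_of_tendsto (h.continuousWithinAt (s := Set.Ioi 0)) ?_
  filter_upwards [self_mem_nhdsWithin] with ε hε
  exact (sys_pos (balanced_base hr ε) (base_pos hr hε) hρ F hF G hG hFG).le

theorem assoc_sq_ge (hF : F ∈ flats r) (hG : G ∈ flats r) (hFG : F ⊂ G) (u : Finset α → ℝ) :
    form₂ (flats r) (assoc r ρ) F G u u * assoc r ρ F G ≤
      form₁ (flats r) (assoc r ρ) F G u ^ 2 := by
  have h : ∀ F G, Continuous fun ε => sys (flats r) ρ (base (flats r) r ε) F G :=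
    continuous_tower (continuous_base r) ρ _ _
  rw [assoc, ← base_zero (L := flats r)]
  refine le_of_tendsto_of_tendsto
    (((continuous_form₂ h F G u u).mul (h F G)).continuousWithinAt (s := Set.Ioi 0))
    (((continuous_form₁ h F G u).pow 2).continuousWithinAt (s := Set.Ioi 0)) ?_
  filter_upwards [self_mem_nhdsWithin] with ε hε
  exact sys_sq_ge (balanced_base hr ε) (base_pos hr hε)
    (fun F hF G hG hFG u => base_sq_ge hr hε hF hG hFG u) hρ F hF G hG hFG u

theorem exists_assoc_pos (hF : F ∈ flats r) (hG : G ∈ flats r) (hFG : F ⊂ G)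
    (h2 : r F + 2 ≤ r G) (hpos : 0 < assoc r ρ F G) :
    ∃ H ∈ between (flats r) F G, 0 < assoc r ρ F H ∧ 0 < assoc r ρ H G := by
  have hb : Balanced (flats r) (covers r) := by
    rw [← base_zero (L := flats r)]; exact balanced_base hr 0
  refine rank_induction (P := fun ρ F G => r F + 2 ≤ r G → 0 < assoc r ρ F G →
    ∃ H ∈ between (flats r) F G, 0 < assoc r ρ F H ∧ 0 < assoc r ρ H G) ?_ ?_ ?_ hρ F hF G hG hFG
    h2 hpos
  · intro F hF G hG hFG h2 hpos
    rw [assoc, sys_card hb hF hG hFG, covers, if_neg (by omega)] at hpos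
    exact absurd hpos (lt_irrefl 0)
  · intro ρ hρ i F hF G hG hFG htriv ih h2 hpos
    have hU := hρ.isUpperSet_redundant (i := i)
    simp only [assoc, hρ.sys_freed] at ih
    rw [modify_of_trivial hU htriv] at ih
    obtain ⟨H, hH, h3, h4⟩ := ih h2 hpos
    have hH' := mem_between.mp hH
    rw [modify_of_trivial hU (htriv.imp_right fun h h' => h (hU hH'.2.2.subset h'))] at h3
    rw [modify_of_trivial hU (htriv.imp_left fun h => hU hH'.2.1.subset h)] at h4
    exact ⟨H, hH, h3, h4⟩
  · intro ρ hρ i F hF G hG hFG hGU hiF _ ih h2 hpos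
    have hU := hρ.isUpperSet_redundant (i := i)
    have hbρ : Balanced (flats r) (assoc r ρ) := hb.sys hρ.mono
    have hUi : ∀ H ∈ redundant ρ i, i ∈ H := fun _ h => h.1
    have hfreed : assoc r (freed ρ i) = modify (flats r) (redundant ρ i) (assoc r ρ) :=
      hρ.sys_freed i
    have nonneg := fun F hF G hG hFG => assoc_nonneg (F := F) (G := G) hr hρ hF hG hFG
    have term : ∀ F ∈ flats r, ∀ G ∈ flats r, ∀ H ∈ between (flats r) F G,
        0 ≤ gap (redundant ρ i) i H * (assoc r ρ F H * assoc r ρ H G) := by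
      intro F hF G hG H hH
      rw [mem_between] at hH
      exact mul_nonneg (gap_nonneg hUi H)
        (mul_nonneg (nonneg F hF H hH.1 hH.2.1) (nonneg H hH.1 G hG hH.2.2))
    have mono : ∀ F ∈ flats r, ∀ G ∈ flats r, F ⊂ G → i ∉ F →
        assoc r (freed ρ i) F G ≤ assoc r ρ F G := by
      intro F hF G hG hFG hiF
      rw [hfreed]
      by_cases hGU : G ∈ redundant ρ i
      · rw [eq_modify_add hUi hbρ hF hG hFG hGU hiF]
        exact le_add_of_nonneg_right (Finset.sum_nonneg (term F hF G hG))
      · rw [modify_of_trivial hU (.inr hGU)]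
    by_contra! hno
    have hzero : ∀ H ∈ between (flats r) F G, assoc r ρ F H * assoc r ρ H G = 0 := by
      intro H hH
      have hH' := mem_between.mp hH
      rcases (nonneg F hF H hH'.1 hH'.2.1).eq_or_lt with h | h
      · rw [← h, zero_mul]
      · rw [le_antisymm (hno H hH h) (nonneg H hH'.1 G hG hH'.2.2), mul_zero]
    have hsame := eq_modify_add hUi hbρ hF hG hFG hGU hiF
    rw [Finset.sum_eq_zero fun H hH => by rw [hzero H hH, mul_zero], add_zero, ← hfreed] at hsame
    obtain ⟨H, hH, h3, h4⟩ := ih h2 (hsame ▸ hpos)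
    have hH' := mem_between.mp hH
    have h3' := h3.trans_le (mono F hF H hH'.1 hH'.2.1 hiF)
    have h4' : assoc r ρ H G = 0 := (mul_eq_zero.mp (hzero H hH)).resolve_left h3'.ne'
    have hiH : i ∈ H := by
      by_contra hiH
      exact absurd (mono H hH'.1 G hG hH'.2.2 hiH) (by rw [h4']; exact h4.not_ge)
    have hHU : H ∉ redundant ρ i := by
      intro hHU
      rw [hfreed, modify_of_trivial hU (.inl hHU), h4'] at h4
      exact lt_irrefl 0 h4
    rw [hfreed, modify, h4', zero_add] at h4
    obtain ⟨K, hK, h5⟩ := Finset.exists_lt_of_sum_lt (s := between (flats r) H G)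
      (f := fun _ => (0 : ℝ))
      (g := fun K => dev H G (ind (redundant ρ i)) K * (assoc r ρ H K * assoc r ρ K G))
      (by rw [Finset.sum_const_zero]; exact h4)
    have hK' := mem_between.mp hK
    have h6 := nonneg H hH'.1 K hK'.1 hK'.2.1
    have h7 := nonneg K hK'.1 G hG hK'.2.2
    have h8 : 0 < assoc r ρ H K * assoc r ρ K G :=
      lt_of_le_of_ne (mul_nonneg h6 h7) fun h => by
      rw [← h, mul_zero] at h5; exact h5.false
    have hKU : K ∈ redundant ρ i := by
      by_contra hKU
      have h9 : dev H G (ind (redundant ρ i)) K ≤ 0 := by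
        have h1 : (H.card : ℝ) < K.card := by exact_mod_cast Finset.card_lt_card hK'.2.1
        have h2 : (K.card : ℝ) < G.card := by exact_mod_cast Finset.card_lt_card hK'.2.2
        have : 0 ≤ ((K.card - H.card : ℝ) / (G.card - H.card)) :=
          div_nonneg (by linarith) (by linarith)
        rw [dev, ind_of_mem hGU, ind_of_notMem hHU, ind_of_notMem hKU]
        linarith
      exact h5.not_ge (mul_nonpos_of_nonpos_of_nonneg h9 h8.le)
    have hFK := hH'.2.1.trans hK'.2.1
    have hHFK : H ∈ between (flats r) F K := mem_between.mpr ⟨hH'.1, hH'.2.1, hK'.2.1⟩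
    have hKFG : K ∈ between (flats r) F G := mem_between.mpr ⟨hK'.1, hFK, hK'.2.2⟩
    have h9 : 0 < assoc r ρ F K := by
      rw [eq_modify_add hUi hbρ hF hK'.1 hFK hKU hiF, ← hfreed]
      refine add_pos_of_nonneg_of_pos (assoc_nonneg hr (hρ.freed i) hF hK'.1 hFK)
        ((mul_pos ?_ (mul_pos h3' (pos_of_mul_pos_left h8 h7))).trans_le
          (Finset.single_le_sum (term F hF K hK'.1) hHFK))
      simp [gap, ind, hiH, hHU]
    have := hzero K hKFG
    exact absurd this (mul_pos h9 (pos_of_mul_pos_right h8 h6)).ne'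

end limit

end

section

variable {α : Type*}

/-- The truncation of a rank function. -/
def trunc (r : Finset α → ℕ) (m : ℕ) (H : Finset α) : ℕ := min (r H) m

theorem trunc_trunc (r : Finset α → ℕ) {m n : ℕ} (h : m ≤ n) :
    trunc (trunc r n) m = trunc r m := by
  funext H; simp only [trunc]; omega

theorem trunc_mono {r : Finset α → ℕ} (hr : Monotone r) (m : ℕ) : Monotone (trunc r m) :=
  fun _ _ h => min_le_min_right m (hr h)

variable [DecidableEq α]

theorem IsRank.trunc {r : Finset α → ℕ} (hr : IsRank r) (m : ℕ) : IsRank (trunc r m) where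
  empty := by simp [BrokenCircuit.trunc, hr.empty]
  mono := trunc_mono hr.mono m
  insert_le i S := by
    have := hr.insert_le i S
    simp only [BrokenCircuit.trunc]; omega
  submod S T := by
    have h1 := hr.submod S T
    have h2 := hr.mono (Finset.inter_subset_left (s₁ := S) (s₂ := T))
    have h3 := hr.mono (Finset.inter_subset_right (s₁ := S) (s₂ := T))
    simp only [BrokenCircuit.trunc]; omega

variable [Fintype α]

theorem mem_flats_trunc {r : Finset α → ℕ} {m : ℕ} {H : Finset α} :
    H ∈ flats (trunc r m) ↔ H = Finset.univ ∨ H ∈ flats r ∧ r H < m := by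
  constructor
  · intro h
    by_cases hH : H = Finset.univ
    · exact .inl hH
    · rw [mem_flats] at h
      refine .inr ⟨mem_flats.mpr fun i hi => ?_, ?_⟩
      · have := h i hi
        simp only [trunc] at this; omega
      · obtain ⟨i, hi⟩ : ∃ i, i ∉ H := by
          by_contra! h'; exact hH (Finset.eq_univ_of_forall h')
        have := h i hi
        simp only [trunc] at this; omega
  · rintro (rfl | ⟨h, hm⟩)
    · exact univ_mem_flats _
    · rw [mem_flats] at h ⊢
      intro i hi
      have := h i hi
      simp only [trunc]; omega

/-- Minus the indicator function of the full set. -/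
noncomputable def top : Finset α → ℝ := (-1 : ℝ) • ind {Finset.univ}

theorem dev_top_of_ne {F G H : Finset α} (hFG : F ⊂ G) (hHG : H ⊂ G) (hG : G ≠ Finset.univ) :
    dev F G (top : Finset α → ℝ) H = 0 := by
  have h : ∀ K : Finset α, K ≠ Finset.univ → top K = 0 := fun K hK => by simp [top, ind, hK]
  refine dev_eq_zero (h _ ?_) (h _ hG) (h _ ?_)
  · rintro rfl; exact hFG.2 (Finset.subset_univ _)
  · rintro rfl; exact hHG.2 (Finset.subset_univ _)

theorem dev_top {F H : Finset α} (hF : F ⊂ Finset.univ) (hH : H ⊂ Finset.univ) :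
    dev F Finset.univ (top : Finset α → ℝ) H =
      (H.card - F.card) / ((Finset.univ : Finset α).card - F.card) := by
  simp [dev, top, ind, hF.ne, hH.ne]

theorem form₁_top_of_ne {L : Finset (Finset α)} {b : Finset α → Finset α → ℝ} {F G : Finset α}
    (hFG : F ⊂ G) (hG : G ≠ Finset.univ) : form₁ L b F G (top : Finset α → ℝ) = 0 :=
  form₁_eq_zero fun _ hH => dev_top_of_ne hFG (mem_between.mp hH).2.2 hG

/-- The system induced by `b` on a truncation. -/
noncomputable def desc (L : Finset (Finset α)) (b : Finset α → Finset α → ℝ)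
    (F G : Finset α) : ℝ :=
  if G = Finset.univ then form₁ L b F G top else b F G

theorem desc_univ (L : Finset (Finset α)) (b : Finset α → Finset α → ℝ) (F : Finset α) :
    desc L b F Finset.univ = form₁ L b F Finset.univ top := if_pos rfl

theorem desc_of_ne (L : Finset (Finset α)) (b : Finset α → Finset α → ℝ) {F G : Finset α}
    (h : G ≠ Finset.univ) : desc L b F G = b F G := if_neg h

section

variable {r : Finset α → ℕ} (hr : IsRank r) {g : ℕ} (hg : r Finset.univ = g + 1)
  {F G H : Finset α} {b : Finset α → Finset α → ℝ}

theorem between_trunc_univ : between (flats (trunc r g)) F Finset.univ =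
    (between (flats r) F Finset.univ).filter fun H => r H < g := by
  ext H
  simp only [mem_between, mem_flats_trunc, Finset.mem_filter]
  constructor
  · rintro ⟨rfl | h1, h2, h3⟩
    · exact absurd rfl h3.ne
    · exact ⟨⟨h1.1, h2, h3⟩, h1.2⟩
  · rintro ⟨⟨h1, h2, h3⟩, h4⟩
    exact ⟨.inr ⟨h1, h4⟩, h2, h3⟩

include hr

theorem between_trunc_of_ne (hG : G ∈ flats (trunc r g)) (h : G ≠ Finset.univ) :
    between (flats (trunc r g)) F G = between (flats r) F G := by
  have hG' := (mem_flats_trunc.mp hG).resolve_left h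
  ext H
  simp only [mem_between, mem_flats_trunc]
  constructor
  · rintro ⟨rfl | h1, h2, h3⟩
    · exact absurd (Finset.subset_univ G) h3.2
    · exact ⟨h1.1, h2, h3⟩
  · rintro ⟨h1, h2, h3⟩
    exact ⟨.inr ⟨h1, (hr.mono h3.subset).trans_lt hG'.2⟩, h2, h3⟩

include hg

theorem split₁_top (hH : H ∈ between (flats r) F Finset.univ) :
    split₁ (flats r) b F H Finset.univ top =
      if r H < g then desc (flats r) b F H * desc (flats r) b H Finset.univ else 0 := by
  rw [mem_between] at hH
  rw [split₁, form₁_top_of_ne hH.2.1 hH.2.2.ne, zero_mul, zero_add]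
  split_ifs with h
  · rw [desc_univ, desc_of_ne _ _ hH.2.2.ne]
  · rw [form₁, hr.between_eq_empty hH.1 (by omega), Finset.sum_empty, mul_zero]

theorem form₂_top (u : Finset α → ℝ) :
    form₂ (flats r) b F Finset.univ u top =
      form₁ (flats (trunc r g)) (desc (flats r) b) F Finset.univ u := by
  rw [form₁, between_trunc_univ, Finset.sum_filter]
  refine Finset.sum_congr rfl fun H hH => ?_
  rw [split₁_top hr hg hH, mul_ite, mul_zero]

theorem desc_modify {U : Set (Finset α)} (hU : IsUpperSet U)
    (hG : G ∈ flats (trunc r g)) :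
    desc (flats r) (modify (flats r) U b) F G =
      modify (flats (trunc r g)) U (desc (flats r) b) F G := by
  by_cases h : G = Finset.univ
  · subst h
    rw [modify, desc_univ, desc_univ, form₁_modify hU, form₂_symm, form₂_top hr hg]
  · rw [modify, desc_of_ne _ _ h, desc_of_ne _ _ h, modify, form₁, form₁,
      between_trunc_of_ne hr hG h]
    congr 1
    refine Finset.sum_congr rfl fun H hH => ?_
    rw [mem_between] at hH
    have hH' : H ≠ Finset.univ := by rintro rfl; exact hH.2.2.2 (Finset.subset_univ G)
    rw [desc_of_ne _ _ h, desc_of_ne _ _ hH']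

theorem desc_tower {ρ : Finset α → ℕ} (hρ : Monotone ρ) {b' : Finset α → Finset α → ℝ}
    (hb : ∀ F ∈ flats (trunc r g), ∀ G ∈ flats (trunc r g), F ⊂ G →
      b' F G = desc (flats r) b F G) (n a : ℕ) :
    ∀ F ∈ flats (trunc r g), ∀ G ∈ flats (trunc r g), F ⊂ G →
      tower (flats (trunc r g)) ρ b' a n F G = desc (flats r) (tower (flats r) ρ b a n) F G := by
  induction n generalizing a with
  | zero => exact hb
  | succ n ih =>
    intro F hF G hG hFG
    rw [tower, tower, desc_modify hr hg (isUpperSet_level hρ a) hG, modify, modify,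
      ih (a + 1) F hF G hG hFG,
      form₁_congr hF hG fun F' hF' G' hG' _ h _ => ih (a + 1) F' hF' G' hG' h]

theorem desc_covers (hF : F ∈ flats (trunc r g)) (hG : G ∈ flats (trunc r g))
    (hFG : F ⊂ G) : covers (trunc r g) F G = desc (flats r) (covers r) F G := by
  have hF' := (mem_flats_trunc.mp hF).resolve_left fun h =>
    hFG.2 (h ▸ Finset.subset_univ G)
  by_cases h : G = Finset.univ
  · subst h
    rw [desc_univ, covers]
    by_cases hrF : r F + 1 = g
    · rw [if_pos (by simp only [trunc]; omega)]
      have hc := hr.sum_card_covers hF'.1 (univ_mem_flats r) hFG (by omega)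
      have hlt : (F.card : ℝ) < (Finset.univ : Finset α).card := by
        exact_mod_cast Finset.card_lt_card hFG
      rw [Finset.filter_true_of_mem] at hc
      · have e1 : ((Finset.univ : Finset α).card - F.card : ℝ) ≠ 0 := by linarith
        rw [← div_self e1, ← hc, Finset.sum_div, hc, form₁]
        refine Finset.sum_congr rfl fun H hH => ?_
        rw [mem_between] at hH
        have h2 := hr.lt_of_ssubset hH.1 hH.2.2
        have h3 := hr.lt_of_ssubset hF'.1 hH.2.1
        rw [dev_top hFG hH.2.2, covers, covers, if_pos (by omega), if_pos (by omega)]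
        ring
      · intro H hH
        rw [mem_between] at hH
        have h2 := hr.lt_of_ssubset hH.1 hH.2.2
        have h3 := hr.lt_of_ssubset hF'.1 hH.2.1
        omega
    · rw [if_neg (by simp only [trunc]; omega), form₁]
      refine (Finset.sum_eq_zero fun H hH => ?_).symm
      by_cases h2 : r H ≤ r F + 1
      · rw [covers.eq_1 r H, if_neg (by omega), mul_zero, mul_zero]
      · rw [covers.eq_1 r F, if_neg h2, zero_mul, mul_zero]
  · rw [desc_of_ne _ _ h, covers, covers]
    have hG' := (mem_flats_trunc.mp hG).resolve_left h
    congr 1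
    simp only [trunc, eq_iff_iff]
    omega

theorem assoc_trunc {ρ : Finset α → ℕ} (hρ : Monotone ρ)
    (hF : F ∈ flats (trunc r g)) (hG : G ∈ flats (trunc r g)) (hFG : F ⊂ G) :
    assoc (trunc r g) ρ F G = desc (flats r) (assoc r ρ) F G :=
  desc_tower hr hg hρ (fun _ hF _ hG hFG => desc_covers hr hg hF hG hFG) _ _ F hF G hG hFG

theorem form₁_assoc_top {ρ : Finset α → ℕ} (hρ : Monotone ρ)
    (hF : F ∈ flats (trunc r g)) (hFG : F ⊂ Finset.univ) :
    form₁ (flats r) (assoc r ρ) F Finset.univ top = assoc (trunc r g) ρ F Finset.univ := by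
  rw [assoc_trunc hr hg hρ hF (univ_mem_flats _) hFG, desc_univ]

theorem form₂_assoc_top {ρ : Finset α → ℕ} (hρ : Monotone ρ)
    (hF : F ∈ flats (trunc r g)) (u : Finset α → ℝ) :
    form₂ (flats r) (assoc r ρ) F Finset.univ u top =
      form₁ (flats (trunc r g)) (assoc (trunc r g) ρ) F Finset.univ u := by
  rw [form₂_top hr hg]
  exact form₁_congr hF (univ_mem_flats _) (fun F hF G hG _ h _ =>
    (assoc_trunc hr hg hρ hF hG h).symm) u

end

end

section

variable {α : Type*}

theorem trunc_univ [Fintype α] {r : Finset α → ℕ} {d : ℕ} (h : d ≤ r Finset.univ) :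
    trunc r d Finset.univ = d := min_eq_right h

variable [DecidableEq α]

theorem tower_of_between_eq_empty {L : Finset (Finset α)} {F G : Finset α}
    (h : between L F G = ∅) (ρ : Finset α → ℕ) (b : Finset α → Finset α → ℝ) (a n : ℕ) :
    tower L ρ b a n F G = b F G := by
  induction n generalizing a with
  | zero => rfl
  | succ n ih => rw [tower, modify, form₁, h, Finset.sum_empty, add_zero, ih]

variable [Fintype α]

/-- The Hodge-theoretic form of the entries of the `h`-vector. -/
noncomputable def hval (r : Finset α → ℕ) (d k : ℕ) : ℝ :=
  assoc (trunc r (d + 1)) (trunc r k) ∅ Finset.univ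

section

variable {r : Finset α → ℕ} (hr : IsRank r) (hl : ∅ ∈ flats r) {d k : ℕ}

include hr

theorem empty_ssubset_univ (h : 0 < r Finset.univ) :
    (∅ : Finset α) ⊂ Finset.univ := by
  rw [Finset.empty_ssubset, Finset.nonempty_iff_ne_empty]
  intro h'
  rw [h', hr.empty] at h
  exact h.false

theorem assoc_trunc_succ (s : Finset α → ℕ) (k : ℕ) : assoc s (trunc r (k + 1)) =
    modify (flats s) (level r (k + 1)) (assoc s (trunc r k)) := by
  refine sys_eq_modify (trunc_mono hr.mono k)
    (fun H => ((hr.trunc k).le_card H).trans (Finset.card_le_univ H))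
    (isUpperSet_level hr.mono (k + 1)) fun H => ?_
  by_cases h : H ∈ level r (k + 1)
  · rw [Set.indicator_of_mem h]
    have : k + 1 ≤ r H := h
    simp only [trunc, Pi.one_apply]; omega
  · rw [Set.indicator_of_notMem h]
    have : ¬ k + 1 ≤ r H := h
    simp only [trunc]; omega

include hl

theorem empty_mem_flats_trunc (hd : 0 < d) : ∅ ∈ flats (trunc r d) :=
  mem_flats_trunc.mpr (.inr ⟨hl, by rwa [hr.empty]⟩)

theorem hval_nonneg (hd : d + 1 ≤ r Finset.univ) : 0 ≤ hval r d k :=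
  assoc_nonneg (hr.trunc _) (hr.trunc _) (empty_mem_flats_trunc hr hl d.succ_pos)
    (univ_mem_flats _) (empty_ssubset_univ hr (by omega))

theorem form₁_top_eq_hval (hd : d + 2 ≤ r Finset.univ) :
    form₁ (flats (trunc r (d + 2))) (assoc (trunc r (d + 2)) (trunc r k)) ∅ Finset.univ top =
      hval r d k := by
  have h := form₁_assoc_top (hr.trunc (d + 2)) (trunc_univ hd) (trunc_mono hr.mono k)
    (F := ∅) (by
      rw [trunc_trunc r (by omega)]
      exact empty_mem_flats_trunc hr hl d.succ_pos) (empty_ssubset_univ hr (by omega))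
  rwa [trunc_trunc r (by omega)] at h

theorem hval_log_concave (hd : d + 3 ≤ r Finset.univ) :
    hval r d k * hval r (d + 2) k ≤ hval r (d + 1) k ^ 2 := by
  have h := assoc_sq_ge (hr.trunc (d + 3)) (hr.trunc k)
    (empty_mem_flats_trunc hr hl (by omega)) (univ_mem_flats _)
    (empty_ssubset_univ hr (by omega)) top
  rw [form₁_top_eq_hval hr hl (d := d + 1) hd, form₂_assoc_top (hr.trunc (d + 3))
    (trunc_univ hd) (trunc_mono hr.mono k) (by
      rw [trunc_trunc r (by omega)]
      exact empty_mem_flats_trunc hr hl (by omega)), trunc_trunc r (by omega),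
    form₁_top_eq_hval hr hl (by omega)] at h
  exact h

theorem hval_pos_of_succ (hd : d + 2 ≤ r Finset.univ) (h : 0 < hval r (d + 1) k) :
    0 < hval r d k := by
  have hr' := hr.trunc (d + 2)
  have h0 := empty_mem_flats_trunc hr hl (d := d + 2) (by omega)
  have hE := empty_ssubset_univ hr (by omega)
  have hu := univ_mem_flats (trunc r (d + 2))
  obtain ⟨H, hH, h1, h2⟩ := exists_assoc_pos hr' (hr.trunc k) h0 hu hE
    (by rw [hr'.empty, trunc_univ hd]; omega) h
  rw [← form₁_top_eq_hval hr hl hd]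
  refine Finset.sum_pos' (fun K hK => ?_) ⟨H, hH, ?_⟩
  · rw [mem_between] at hK
    rw [dev_top hE hK.2.2]
    refine mul_nonneg ?_ (mul_nonneg (assoc_nonneg hr' (hr.trunc k) h0 hK.1 hK.2.1)
      (assoc_nonneg hr' (hr.trunc k) hK.1 hu hK.2.2))
    simp only [Finset.card_empty, Nat.cast_zero, sub_zero]
    positivity
  · rw [mem_between] at hH
    rw [dev_top hE hH.2.2]
    refine mul_pos ?_ (mul_pos h1 h2)
    have h3 : 0 < H.card := Finset.card_pos.mpr (Finset.empty_ssubset.mp hH.2.1)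
    have h4 : 0 < (Finset.univ : Finset α).card := Finset.card_pos.mpr (Finset.empty_ssubset.mp hE)
    simp only [Finset.card_empty, Nat.cast_zero, sub_zero]
    positivity

theorem hval_zero (h : 0 < r Finset.univ) : hval r 0 k = 1 := by
  have hr' := hr.trunc 1
  have h1 : trunc r 1 Finset.univ ≤ trunc r 1 ∅ + 1 := by rw [trunc_univ h, hr'.empty]
  rw [hval, assoc, sys, tower_of_between_eq_empty
    (hr'.between_eq_empty (empty_mem_flats_trunc hr hl one_pos) h1), covers, if_pos h1]

theorem hval_succ_succ (hdk : d + 1 ≤ k) (hk : k + 1 ≤ r Finset.univ) :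
    hval r (d + 1) (k + 1) = hval r (d + 1) k - hval r d k := by
  have hE := empty_ssubset_univ hr (by omega)
  rw [hval, assoc_trunc_succ hr, modify, ← form₁_top_eq_hval hr hl (d := d) (by omega), sub_eq_add_neg,
    ← neg_one_mul, ← form₁_smul]
  · congr 1
    refine Finset.sum_congr rfl fun H hH => ?_
    rw [mem_between] at hH
    congr 1
    have h1 : r H < d + 2 := ((mem_flats_trunc.mp hH.1).resolve_left hH.2.2.ne).2
    rw [dev_smul, dev_top hE hH.2.2, dev, ind_of_notMem (H := ∅), ind_of_notMem (H := H),
      ind_of_mem (H := Finset.univ)]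
    · ring
    · exact hk
    · exact fun h : k + 1 ≤ r H => by omega
    · simp [level, hr.empty]

end

end

section

variable {α : Type*} [DecidableEq α]

/-- The signed alternating sum over the subsets of `G` of rank at most `g`. -/
def altSum (r : Finset α → ℕ) (g : ℕ) (G : Finset α) : ℤ :=
  (-1) ^ g * ∑ S ∈ G.powerset with r S < g + 1, (-1) ^ S.card

variable [Fintype α] {r : Finset α → ℕ} (hr : IsRank r)
include hr

theorem assoc_of_covers (ρ : Finset α → ℕ) {F G : Finset α} (hF : F ∈ flats r)
    (h : r G ≤ r F + 1) : assoc r ρ F G = 1 := by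
  rw [assoc, sys, tower_of_between_eq_empty (hr.between_eq_empty hF h), covers, if_pos h]

theorem assoc_trunc_eq_zero (a : ℕ) : ∀ F ∈ flats r, ∀ G ∈ flats r, F ⊂ G → r F + 2 ≤ r G →
    a + 2 ≤ r G → assoc r (trunc r a) F G = 0 := by
  induction a with
  | zero =>
    intro F _ G _ _ h _
    have h0 : trunc r 0 = fun _ => 0 := funext fun H => Nat.min_zero _
    rw [h0, assoc, sys_zero, covers, if_neg (by omega)]
  | succ a ih =>
    intro F hF G hG hFG h2 ha
    have hU := isUpperSet_level hr.mono (a + 1)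
    rw [assoc_trunc_succ hr]
    by_cases hFU : F ∈ level r (a + 1)
    · rw [modify_of_trivial hU (.inl hFU), ih F hF G hG hFG h2 (by omega)]
    · rw [modify, ih F hF G hG hFG h2 (by omega), zero_add]
      have hFa : ¬ a + 1 ≤ r F := hFU
      refine Finset.sum_eq_zero fun H hH => ?_
      rw [mem_between] at hH
      by_cases h : r H + 2 ≤ r G
      · rw [ih H hH.1 G hG hH.2.2 h (by omega), mul_zero, mul_zero]
      · rw [ih F hF H hH.1 hH.2.1 (by omega) (by omega), zero_mul, mul_zero]

theorem assoc_trunc_eq_sum (hl : ∅ ∈ flats r) {g : ℕ} {G : Finset α} (hG : G ∈ flats r)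
    (h : r G = g + 2) : assoc r (trunc r (g + 1)) ∅ G =
      ∑ H ∈ (between (flats r) ∅ G).filter (fun H => r H = g + 1),
        (1 - H.card / G.card) * assoc r (trunc r g) ∅ H := by
  have hG0 : ∅ ⊂ G := by
    rw [Finset.empty_ssubset, Finset.nonempty_iff_ne_empty]
    rintro rfl
    rw [hr.empty] at h; omega
  rw [assoc_trunc_succ hr, modify, assoc_trunc_eq_zero hr g ∅ hl G hG hG0 (by rw [hr.empty]; omega)
    (by omega), zero_add, form₁, Finset.sum_filter]
  refine Finset.sum_congr rfl fun H hH => ?_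
  rw [mem_between] at hH
  have hlt := hr.lt_of_ssubset hH.1 hH.2.2
  split_ifs with h1
  · rw [assoc_of_covers hr _ hH.1 (by omega), mul_one, dev, ind_of_notMem (H := ∅), ind_of_mem,
      ind_of_mem]
    · simp
    · exact (by omega : g + 1 ≤ r G)
    · exact h1.ge
    · simp [level, hr.empty]
  · rw [assoc_trunc_eq_zero hr g H hH.1 G hG hH.2.2 (by omega) (by omega), mul_zero, mul_zero]

theorem IsRank.clo_eq {H S : Finset α} (hH : H ∈ flats r) (hS : S ⊆ H) (h : r S = r H) :
    clo r S = H := by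
  by_contra hne
  have := hr.lt_of_ssubset (hr.clo_mem S) ((hr.clo_subset hH hS).ssubset_of_ne hne)
  rw [hr.rank_clo] at this
  omega

theorem altSum_succ {g : ℕ} {G : Finset α} (hG : G ∈ flats r) (h : r G = g + 2)
    {i : α} (hi : i ∈ G) : altSum r (g + 1) G =
      ∑ H ∈ ((between (flats r) ∅ G).filter fun H => r H = g + 1) with i ∉ H, altSum r g H := by
  set s := (G.erase i).powerset.filter fun S => r S = g + 1 ∧ r (insert i S) = g + 2 with hs
  have h1 : ∑ S ∈ G.powerset with r S < g + 2, (-1 : ℤ) ^ S.card = ∑ S ∈ s, (-1) ^ S.card := by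
    rw [Finset.sum_filter, Finset.sum_filter]
    conv_lhs => rw [← Finset.insert_erase hi]
    rw [Finset.sum_powerset_insert (Finset.notMem_erase i G), ← Finset.sum_add_distrib]
    refine Finset.sum_congr rfl fun S hS => ?_
    rw [Finset.mem_powerset] at hS
    have hiS : i ∉ S := fun h => Finset.notMem_erase i G (hS h)
    have := hr.insert_le i S
    have := hr.mono (Finset.subset_insert i S)
    have : r (insert i S) ≤ r G :=
      hr.mono (Finset.insert_subset hi (hS.trans (Finset.erase_subset i G)))
    rw [Finset.card_insert_of_notMem hiS, pow_succ]
    split_ifs <;> omega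
  have h2 : ∀ S ∈ s, clo r S ∈
      ((between (flats r) ∅ G).filter fun H => r H = g + 1).filter fun H => i ∉ H := by
    intro S hS
    simp only [hs, Finset.mem_filter, Finset.mem_powerset] at hS
    have hSG : clo r S ⊆ G := hr.clo_subset hG (hS.1.trans (Finset.erase_subset i G))
    have hiS : i ∉ clo r S := fun h => by
      have := mem_clo.mp h
      omega
    simp only [Finset.mem_filter, mem_between, hr.clo_mem, hr.rank_clo, hS, true_and, and_true,
      Finset.empty_ssubset]
    refine ⟨⟨?_, hSG.ssubset_of_ne fun h => hiS (h ▸ hi)⟩, hiS⟩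
    rw [Finset.nonempty_iff_ne_empty]
    intro h
    have := hr.rank_clo S
    rw [h, hr.empty] at this
    omega
  rw [altSum, h1, ← Finset.sum_fiberwise_of_maps_to h2, Finset.mul_sum]
  refine Finset.sum_congr rfl fun H hH => ?_
  simp only [Finset.mem_filter, mem_between] at hH
  obtain ⟨⟨⟨hHL, hH0, hHG⟩, hHg⟩, hiH⟩ := hH
  have h3 : s.filter (fun S => clo r S = H) = H.powerset.filter fun S => ¬ r S < g + 1 := by
    ext S
    simp only [hs, Finset.mem_filter, Finset.mem_powerset]
    constructor
    · rintro ⟨⟨hSG, hSr, -⟩, rfl⟩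
      exact ⟨subset_clo r S, by omega⟩
    · rintro ⟨hSH, hSr⟩
      have hSr' : r S = r H := by
        have := hr.mono hSH
        omega
      have hc := hr.clo_eq hHL hSH hSr'
      refine ⟨⟨fun x hx => Finset.mem_erase.mpr ⟨?_, hHG.subset (hSH hx)⟩, by omega, ?_⟩, hc⟩
      · rintro rfl
        exact hiH (hSH hx)
      · have := mt mem_clo.mpr (hc.symm ▸ hiH)
        have := hr.insert_le i S
        have := hr.mono (Finset.subset_insert i S)
        omega
  have h4 := Finset.sum_filter_add_sum_filter_not H.powerset (fun S => r S < g + 1)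
    fun S => (-1 : ℤ) ^ S.card
  rw [Finset.sum_powerset_neg_one_pow_card_of_nonempty (Finset.empty_ssubset.mp hH0)] at h4
  rw [h3, altSum, eq_neg_of_add_eq_zero_right h4]
  ring

theorem assoc_trunc_eq_altSum (hl : ∅ ∈ flats r) (g : ℕ) : ∀ G ∈ flats r, r G = g + 1 →
    assoc r (trunc r g) ∅ G = altSum r g G := by
  induction g with
  | zero =>
    intro G _ h
    have h1 : G.powerset.filter (fun S => r S < 0 + 1) = {∅} := by
      ext S
      simp only [Finset.mem_filter, Finset.mem_powerset, Finset.mem_singleton]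
      constructor
      · rintro ⟨-, h0⟩
        by_contra hne
        have := hr.lt_of_ssubset hl (Finset.empty_ssubset.mpr (Finset.nonempty_iff_ne_empty.mpr hne))
        omega
      · rintro rfl
        exact ⟨Finset.empty_subset G, by rw [hr.empty]; omega⟩
    rw [assoc_of_covers hr _ hl (by omega), altSum, h1]
    simp
  | succ g ih =>
    intro G hG h
    set C := (between (flats r) ∅ G).filter fun H => r H = g + 1
    have hC : ∀ H ∈ C, H ∈ flats r ∧ H ⊂ G ∧ r H = g + 1 := fun H hH => by
      simp only [C, Finset.mem_filter, mem_between] at hH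
      exact ⟨hH.1.1, hH.1.2.2, hH.2⟩
    have h0 : G.card ≠ 0 := by
      rw [Finset.card_ne_zero, Finset.nonempty_iff_ne_empty]
      rintro rfl
      rw [hr.empty] at h; omega
    have h1 : (G.card : ℤ) * altSum r (g + 1) G = ∑ H ∈ C, (G.card - H.card) * altSum r g H := by
      rw [← nsmul_eq_mul, ← Finset.sum_const]
      refine (Finset.sum_congr rfl fun i hi => altSum_succ hr hG h hi).trans ?_
      simp only [Finset.sum_filter (fun H => _ ∉ H) (altSum r g)]
      rw [Finset.sum_comm]
      refine Finset.sum_congr rfl fun H hH => ?_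
      rw [← Finset.sum_filter, Finset.sum_const, nsmul_eq_mul, ← Finset.sdiff_eq_filter,
        Finset.cast_card_sdiff (hC H hH).2.1.subset]
    have h2 : (G.card : ℝ) * altSum r (g + 1) G =
        ∑ H ∈ C, ((G.card : ℝ) - H.card) * altSum r g H := by
      exact_mod_cast h1
    have h0' : (G.card : ℝ) ≠ 0 := by exact_mod_cast h0
    rw [assoc_trunc_eq_sum hr hl hG h, ← mul_right_inj' h0', h2, Finset.mul_sum]
    refine Finset.sum_congr rfl fun H hH => ?_
    rw [ih H (hC H hH).1 (hC H hH).2.2]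
    field_simp

theorem hval_self (hl : ∅ ∈ flats r) {d : ℕ} (hd : d + 1 ≤ r Finset.univ) :
    hval r d d = (altSum r d Finset.univ : ℝ) := by
  have h := assoc_trunc_eq_altSum (hr.trunc (d + 1)) (empty_mem_flats_trunc hr hl d.succ_pos) d
    Finset.univ (univ_mem_flats _) (trunc_univ hd)
  rw [trunc_trunc r (Nat.le_succ d)] at h
  rw [hval, h, altSum, altSum]
  simp [trunc]

/-- The combinatorial expression for the entries of the `h`-vector. -/
theorem hval_eq (hl : ∅ ∈ flats r) {k d : ℕ} (hdk : d ≤ k) (hd : d + 1 ≤ r Finset.univ)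
    (hk : k ≤ r Finset.univ) :
    hval r d k = (((-1) ^ d * ∑ S : Finset α with r S ≤ d,
      (-1) ^ S.card * ((k - r S).choose (d - r S) : ℤ) : ℤ) : ℝ) := by
  induction k generalizing d with
  | zero =>
    obtain rfl : d = 0 := by omega
    rw [hval_self hr hl hd, altSum]
    simp
  | succ k ih =>
    rcases hdk.eq_or_lt with rfl | hlt
    · rw [hval_self hr hl hd, altSum]
      simp
    · cases d with
      | zero =>
        rw [hval_zero hr hl (by omega), ← hval_zero hr hl (k := k) (by omega),
          ih (by omega) hd (by omega)]
        simp
      | succ d =>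
        rw [hval_succ_succ hr hl (by omega) hk, ih (by omega) hd (by omega),
          ih (by omega) (by omega) (by omega), ← Int.cast_sub]
        congr 1
        rw [pow_succ, mul_assoc, mul_assoc, ← mul_sub, neg_one_mul, neg_one_mul,
          ← neg_add']
        congr 2
        rw [Finset.sum_filter, Finset.sum_filter, Finset.sum_filter, ← Finset.sum_add_distrib]
        refine Finset.sum_congr rfl fun S _ => ?_
        by_cases h1 : r S ≤ d
        · rw [if_pos h1, if_pos (by omega), if_pos (by omega), Nat.succ_sub h1,
            Nat.succ_sub (by omega : r S ≤ k), Nat.choose_succ_succ]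
          push_cast; ring
        · rw [if_neg h1, add_zero]
          split_ifs with h2
          · rw [show d + 1 - r S = 0 by omega, Nat.choose_zero_right, Nat.choose_zero_right]
          · rfl

end

section

theorem exists_unimodal {h : ℕ → ℤ} {n : ℕ} (nonneg : ∀ d ≤ n, 0 ≤ h d)
    (log_concave : ∀ d, d + 2 ≤ n → h d * h (d + 2) ≤ h (d + 1) ^ 2)
    (pos : ∀ d, d + 1 ≤ n → 0 < h (d + 1) → 0 < h d) :
    ∃ k₀ ≤ n, (∀ i j : ℕ, i ≤ j → j ≤ k₀ → h i ≤ h j) ∧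
      (∀ i j : ℕ, k₀ ≤ i → i ≤ j → j ≤ n → h j ≤ h i) := by
  have step : ∀ d, d + 2 ≤ n → h (d + 1) ≤ h d → h (d + 2) ≤ h (d + 1) := by
    intro d hd h1
    by_contra! h2
    have p2 : 0 < h (d + 2) := (nonneg (d + 1) (by omega)).trans_lt h2
    have p1 := pos (d + 1) (by omega) p2
    have := log_concave d hd
    nlinarith
  have ex : ∃ d, n ≤ d ∨ h (d + 1) ≤ h d := ⟨n, .inl le_rfl⟩
  classical
  set k₀ := Nat.find ex with hk₀
  have hle : k₀ ≤ n := Nat.find_min' ex (.inl le_rfl)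
  refine ⟨k₀, hle, fun i j hij => ?_, fun i j hi hij => ?_⟩
  · induction j, hij using Nat.le_induction with
    | base => exact fun _ => le_rfl
    | succ j _ ih =>
      intro hj
      have := Nat.find_min ex (m := j) (by omega)
      push Not at this
      exact (ih (by omega)).trans this.2.le
  · have down : ∀ m, k₀ ≤ m → m + 1 ≤ n → h (m + 1) ≤ h m := by
      intro m hm
      induction m, hm using Nat.le_induction with
      | base =>
        intro hm
        exact (Nat.find_spec ex).resolve_left (by omega)
      | succ m _ ih => exact fun hm => step m hm (ih (by omega))
    induction j, hij using Nat.le_induction with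
    | base => exact fun _ => le_rfl
    | succ j hij ih => exact fun hj => (down j (hi.trans hij) hj).trans (ih (by omega))

theorem coe_matroidRank {α : Type*} [Finite α] (M : Matroid α) (X : Set α) :
    (matroidRank M X : ℕ∞) = M.eRk X := by
  obtain ⟨I, hI⟩ := M.exists_isBasis' X
  have h : IsGreatest {m | ∃ I ⊆ X, M.Indep I ∧ I.ncard = m} I.ncard := by
    refine ⟨⟨I, hI.subset, hI.indep, rfl⟩, ?_⟩
    rintro _ ⟨J, hJX, hJ, rfl⟩
    have := hJ.encard_le_eRk_of_subset hJX
    rw [hI.eRk_eq_encard, ← J.toFinite.cast_ncard_eq, ← I.toFinite.cast_ncard_eq] at this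
    exact_mod_cast this
  rw [matroidRank, h.csSup_eq, hI.eRk_eq_encard, I.toFinite.cast_ncard_eq]

theorem isRank_matroidRank {α : Type*} [DecidableEq α] [Finite α] (M : Matroid α) :
    IsRank fun S : Finset α => matroidRank M ↑S where
  empty := by
    have := coe_matroidRank M ∅
    rw [M.eRk_empty] at this
    simpa using this
  mono S T h := by
    have := M.eRk_mono (Finset.coe_subset.mpr h)
    rw [← coe_matroidRank, ← coe_matroidRank] at this
    exact_mod_cast this
  insert_le i S := by
    have := M.eRk_insert_le_add_one i S
    rw [← coe_matroidRank, ← coe_matroidRank] at this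
    rw [Finset.coe_insert]
    exact_mod_cast this
  submod S T := by
    have := M.eRk_inter_add_eRk_union_le S T
    simp only [← coe_matroidRank] at this
    rw [Finset.coe_union, Finset.coe_inter, add_comm]
    exact_mod_cast this

theorem coeff_charPoly_comp {α : Type*} [Fintype α] (M : Matroid α) (r n : ℕ) :
    ((matroidCharPoly M r).comp (X + 1)).coeff n =
      ∑ S : Finset α, (-1) ^ S.card * ((r + 1 - matroidRank M ↑S).choose n : ℤ) := by
  simp only [matroidCharPoly, Polynomial.sum_comp, Polynomial.finsetSum_coeff]
  refine Finset.sum_congr rfl fun S _ => ?_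
  rw [show ((-1 : ℤ[X]) ^ S.card) = C ((-1) ^ S.card) by simp, mul_comp, C_comp, X_pow_comp,
    coeff_C_mul, coeff_X_add_one_pow]

theorem hvector_eq {R k : ℕ} (hk : k ≤ R) {h : ℕ → ℤ} {p : ℤ[X]}
    (hh : p = ∑ k ∈ Finset.range (R + 1), C ((-1) ^ k * h k) * X ^ (R - k)) :
    h k = (-1) ^ k * p.coeff (R - k) := by
  rw [hh, Polynomial.finsetSum_coeff, Finset.sum_eq_single k]
  · rw [coeff_C_mul, coeff_X_pow_self, mul_one, ← mul_assoc, ← mul_pow]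
    simp
  · intro j hj hne
    rw [Finset.mem_range] at hj
    rw [coeff_C_mul_X_pow, if_neg (by omega)]
  · intro h'
    rw [Finset.mem_range] at h'
    omega

theorem sum_eq_zero_of_loop {α : Type*} [DecidableEq α] [Fintype α] {rk : Finset α → ℕ}
    (hr : IsRank rk) (hl : ∅ ∉ flats rk) (f : ℕ → ℤ) :
    ∑ S : Finset α, (-1) ^ S.card * f (rk S) = 0 := by
  simp only [mem_flats, not_forall, not_lt] at hl
  obtain ⟨i, -, hi⟩ := hl
  have hi' : rk (insert i ∅) = rk ∅ := hi.antisymm (hr.mono (Finset.empty_subset _))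
  rw [← Finset.powerset_univ, ← Finset.insert_erase (Finset.mem_univ i),
    Finset.sum_powerset_insert (Finset.notMem_erase i _), ← Finset.sum_add_distrib]
  refine Finset.sum_eq_zero fun S hS => ?_
  rw [Finset.mem_powerset] at hS
  rw [Finset.card_insert_of_notMem fun h => Finset.notMem_erase i _ (hS h), pow_succ,
    hr.insert_eq_of_subset (Finset.empty_subset S) hi']
  ring

theorem choose_sub_sub {R k s : ℕ} (hk : k ≤ R) (hs : s ≤ R) :
    (R - s).choose (R - k) = if s ≤ k then (R - s).choose (k - s) else 0 := by
  split_ifs with h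
  · exact Nat.choose_symm_of_eq_add (by omega)
  · exact Nat.choose_eq_zero_of_lt (by omega)

theorem hval_eq_sum_choose {α : Type*} [DecidableEq α] [Fintype α] {rk : Finset α → ℕ}
    (hr : IsRank rk) (hl : ∅ ∈ flats rk) {k : ℕ} (hk : k + 1 ≤ rk Finset.univ) :
    hval rk k (rk Finset.univ) = (((-1) ^ k * ∑ S : Finset α,
      (-1) ^ S.card * ((rk Finset.univ - rk S).choose (rk Finset.univ - k) : ℤ) : ℤ) : ℝ) := by
  rw [hval_eq hr hl (by omega) hk le_rfl, Finset.sum_filter]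
  congr 2
  refine Finset.sum_congr rfl fun S _ => ?_
  rw [choose_sub_sub (by omega) (hr.mono (Finset.subset_univ S))]
  split_ifs <;> simp

end

end BrokenCircuit

open BrokenCircuit

/-- **Unimodality of the h-vector of the broken circuit complex.**
If `M` is a matroid of rank `r + 1` on a finite ground set and `h` is the h-vector of its
broken circuit complex, defined by `χ_M(q+1) = Σ_{k=0}^{r+1} (−1)^k h_k q^{r+1−k}`, then
there is an index `k₀ ≤ r+1` with `h_0 ≤ … ≤ h_{k₀} ≥ … ≥ h_{r+1}`. -/
theorem hvector_brokenCircuit_unimodal {α : Type*} [Fintype α] (M : Matroid α)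
    (hE : M.E = Set.univ) (r : ℕ) (hrank : matroidRank M Set.univ = r + 1)
    (h : ℕ → ℤ)
    (hh : (matroidCharPoly M r).comp (X + 1) =
      ∑ k ∈ Finset.range (r + 2), C ((-1) ^ k * h k) * X ^ (r + 1 - k)) :
    ∃ k₀ ≤ r + 1,
      (∀ i j : ℕ, i ≤ j → j ≤ k₀ → h i ≤ h j) ∧
      (∀ i j : ℕ, k₀ ≤ i → i ≤ j → j ≤ r + 1 → h j ≤ h i) := by
  classical
  have hr := isRank_matroidRank M
  set rk : Finset α → ℕ := fun S => matroidRank M ↑S with hrk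
  have hR : rk Finset.univ = r + 1 := by rw [hrk, ← hrank]; simp
  have hsum : ∀ k ≤ r + 1, h k = (-1) ^ k *
      ∑ S : Finset α, (-1) ^ S.card * ((r + 1 - rk S).choose (r + 1 - k) : ℤ) :=
    fun k hk => by rw [hvector_eq hk hh, coeff_charPoly_comp]
  have hne := empty_ssubset_univ hr (by omega)
  have hlast : h (r + 1) = 0 := by
    have := Finset.sum_powerset_neg_one_pow_card_of_nonempty (Finset.empty_ssubset.mp hne)
    rw [Finset.powerset_univ] at this
    simp [hsum (r + 1) le_rfl, this]
  by_cases hl : ∅ ∈ flats rk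
  · have hval' : ∀ k ≤ r, (h k : ℝ) = hval rk k (r + 1) := fun k hk => by
      have := hval_eq_sum_choose hr hl (k := k) (by omega)
      rw [hR] at this
      rw [this, ← hsum k (by omega)]
    refine exists_unimodal (fun d hd => ?_) (fun d hd => ?_) fun d hd hpos => ?_
    · rcases hd.eq_or_lt with rfl | hd
      · exact hlast.ge
      · have := hval_nonneg hr hl (d := d) (k := r + 1) (by omega)
        rw [← hval' d (by omega)] at this
        exact_mod_cast this
    · rcases hd.eq_or_lt with hd | hd
      · rw [hd, hlast, mul_zero]
        exact sq_nonneg _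
      · have := hval_log_concave hr hl (d := d) (k := r + 1) (by omega)
        rw [← hval' d (by omega), ← hval' (d + 1) (by omega), ← hval' (d + 2) (by omega)] at this
        exact_mod_cast this
    · rcases hd.eq_or_lt with hd | hd
      · rw [hd, hlast] at hpos
        exact absurd hpos (lt_irrefl 0)
      · have := hval_pos_of_succ hr hl (d := d) (k := r + 1) (by omega)
        rw [← hval' d (by omega), ← hval' (d + 1) (by omega)] at this
        exact_mod_cast this (by exact_mod_cast hpos)
  · have h0 : ∀ k ≤ r + 1, h k = 0 := fun k hk => by
      rw [hsum k hk, sum_eq_zero_of_loop hr hl fun s => ((r + 1 - s).choose (r + 1 - k) : ℤ),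
        mul_zero]
    refine ⟨0, Nat.zero_le _, fun i j hij hj => ?_, fun i j _ hij hj => ?_⟩
    · rw [h0 i (by omega), h0 j (by omega)]
    · rw [h0 i (by omega), h0 j (by omega)]
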